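/- arXiv:2507.12392 — 12 statements merged into one kernel-verified Lean document; each statement's English description precedes it below -/
import Mathlib

section
/- Fix α ∈ ℝ with α ≠ 0, r > 0 and q ∈ ℝ³. The sphere of radius r centered at q is an α-stationary surface — that is, for every p ∈ ℝ³ with ‖p − q‖ = r and p ≠ 0 one has 2/r = α·⟨q − p, p⟩/(r·‖p‖²) — if and only if either (α = −2 and q = 0) or (α = −4 and ‖q‖ = r). -/
open Real
open scoped RealInnerProductSpace

lemma stationary_at_iff {E : Type*} [NormedAddCommGroup E] [InnerProductSpace ℝ E]
    {α r : ℝ} (hr : 0 < r) {q u : E} (hu : ‖u‖ = 1) (hp : q + r • u ≠ 0) :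
    2 / r = α * ⟪q - (q + r • u), q + r • u⟫ / (r * ‖q + r • u‖ ^ 2) ↔
      2 * (‖q‖ ^ 2 + r ^ 2) + (4 + α) * r * ⟪q, u⟫ + α * r ^ 2 = 0 := by
  have hpn : 0 < ‖q + r • u‖ := norm_pos_iff.mpr hp
  have hnorm : ‖q + r • u‖ ^ 2 = ‖q‖ ^ 2 + 2 * r * ⟪q, u⟫ + r ^ 2 := by
    rw [norm_add_sq_real, inner_smul_right, norm_smul, hu, Real.norm_of_nonneg hr.le]
    ring
  have hinner : ⟪q - (q + r • u), q + r • u⟫ = -r * ⟪q, u⟫ - r ^ 2 := by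
    rw [sub_add_cancel_left, inner_neg_left, inner_add_right, inner_smul_left, inner_smul_left,
      inner_smul_right, real_inner_self_eq_norm_sq, hu, real_inner_comm]
    simp
    ring
  rw [div_eq_div_iff hr.ne' (by positivity), hinner, hnorm]
  constructor
  · intro h
    apply mul_left_cancel₀ hr.ne'
    linear_combination h
  · intro h
    linear_combination r * h

/-- A sphere of radius `r` centered at `q` is an `α`-stationary surface
(i.e. `2/r = α·⟨q − p, p⟩/(r·‖p‖²)` at every point `p` of the sphere with `p ≠ 0`)
iff `α = −2` and `q = 0`, or `α = −4` and `‖q‖ = r`. -/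
theorem stationary_spheres (α : ℝ) (hα : α ≠ 0) (r : ℝ) (hr : 0 < r)
    (q : EuclideanSpace ℝ (Fin 3)) :
    (∀ p : EuclideanSpace ℝ (Fin 3), ‖p - q‖ = r → p ≠ 0 →
      2 / r = α * ⟪q - p, p⟫ / (r * ‖p‖ ^ 2)) ↔
    ((α = -2 ∧ q = 0) ∨ (α = -4 ∧ ‖q‖ = r)) := by
  constructor
  · intro h
    have key (u : EuclideanSpace ℝ (Fin 3)) (hu : ‖u‖ = 1) (hp : q + r • u ≠ 0) :
        2 * (‖q‖ ^ 2 + r ^ 2) + (4 + α) * r * ⟪q, u⟫ + α * r ^ 2 = 0 :=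
      (stationary_at_iff hr hu hp).mp
        (h _ (by rw [add_sub_cancel_left, norm_smul, hu, Real.norm_of_nonneg hr.le, mul_one]) hp)
    by_cases hq : q = 0
    · left
      subst hq
      obtain ⟨u, hu⟩ := exists_norm_eq (EuclideanSpace ℝ (Fin 3)) zero_le_one
      have hu0 : u ≠ 0 := by
        rintro rfl
        simp at hu
      have hk := key u hu (by simpa using ⟨hr.ne', hu0⟩)
      simp only [norm_zero, inner_zero_left] at hk
      refine ⟨mul_right_cancel₀ (pow_ne_zero 2 hr.ne') ?_, rfl⟩
      linear_combination hk
    · right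
      have hn : 0 < ‖q‖ := norm_pos_iff.mpr hq
      have axis (ε : ℝ) (hε : |ε| = 1) (hne : ‖q‖ + r * ε ≠ 0) :
          2 * (‖q‖ ^ 2 + r ^ 2) + (4 + α) * r * (ε * ‖q‖) + α * r ^ 2 = 0 := by
        have hk := key ((ε / ‖q‖) • q) ?_ ?_
        · rw [inner_smul_right, real_inner_self_eq_norm_sq] at hk
          rw [← hk]
          field_simp
        · rw [norm_smul, norm_div, norm_norm, Real.norm_eq_abs, hε]
          field_simp
        · have : q + r • (ε / ‖q‖) • q = ((‖q‖ + r * ε) / ‖q‖) • q := by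
            rw [smul_smul, add_div, div_self hn.ne', add_smul, one_smul, mul_div_assoc]
          rw [this]
          exact smul_ne_zero (div_ne_zero hne hn.ne') hq
      have h₁ := axis 1 (by simp) (by positivity)
      by_cases hqr : ‖q‖ = r
      · refine ⟨?_, hqr⟩
        rw [hqr] at h₁
        apply mul_right_cancel₀ (pow_ne_zero 2 hr.ne')
        linear_combination h₁ / 2
      · have h₂ := axis (-1) (by simp) (fun h₀ => hqr (by linarith))
        have hα4 : α = -4 := by
          apply mul_right_cancel₀ (mul_pos hr hn).ne'
          linear_combination (h₁ - h₂) / 2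
        subst hα4
        refine ⟨rfl, (sq_eq_sq₀ hn.le hr.le).mp ?_⟩
        linear_combination h₁ / 2
  · intro h p hp hp0
    obtain ⟨u, rfl⟩ : ∃ u, p = q + r • u :=
      ⟨r⁻¹ • (p - q), by rw [smul_inv_smul₀ hr.ne', add_sub_cancel]⟩
    have hu : ‖u‖ = 1 := by
      rw [add_sub_cancel_left, norm_smul, Real.norm_of_nonneg hr.le] at hp
      exact mul_left_cancel₀ hr.ne' (hp.trans (mul_one r).symm)
    rw [stationary_at_iff hr hu hp0]
    rcases h with ⟨rfl, rfl⟩ | ⟨rfl, hq⟩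
    · simp
    · rw [hq]
      ring
end

section
/- Let α ≠ 0, q₁ ∈ ℝ, let I ⊆ ℝ be a nonempty open interval, and let x, z, ψ : I → ℝ be differentiable functions with x(s) > 0, x'(s) = cos ψ(s) and z'(s) = sin ψ(s) on I. Suppose the rotational surface about the axis {x = q₁, y = 0}, parametrized by Φ(s,t) = (q₁ + x(s)cos t, x(s)sin t, z(s)), is α-stationary, i.e. for all s ∈ I and all t ∈ ℝ such that D(s,t) := q₁² + x(s)² + z(s)² + 2q₁x(s)cos t ≠ 0 it holds that ψ'(s) + sin ψ(s)/x(s) = α·(z(s)cos ψ(s) − sin ψ(s)·(q₁ cos t + x(s)))/D(s,t). Then either q₁ = 0 (the rotation axis passes through the origin), or z(s) = 0 for all s ∈ I, or α = −4 and there exists c ∈ ℝ such that x(s)² + (z(s) − c)² = q₁² + c² for all s ∈ I (the generating curve lies on a circle whose corresponding sphere of revolution passes through the origin). -/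
open Real Set

theorem eq_of_hasDerivAt_zero_on_Ioo {f : ℝ → ℝ} {a b : ℝ}
    (hf : ∀ s ∈ Ioo a b, HasDerivAt f 0 s) {s t : ℝ} (hs : s ∈ Ioo a b) (ht : t ∈ Ioo a b) :
    f s = f t :=
  isOpen_Ioo.is_const_of_deriv_eq_zero isPreconnected_Ioo
    (fun u hu => (hf u hu).differentiableAt.differentiableWithinAt)
    (fun u hu => (hf u hu).deriv) hs ht

/-- Comparing the stationarity equation at `t = π / 2` and `t = π / 3` separates the
coefficients of `1` and `cos t`. -/
theorem stationary_coefficients {α q x z S C h : ℝ} (hq : q ≠ 0) (hx : 0 < x)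
    (heq : ∀ t : ℝ, q ^ 2 + x ^ 2 + z ^ 2 + 2 * q * x * cos t ≠ 0 →
      h = α * (z * C - S * (q * cos t + x)) / (q ^ 2 + x ^ 2 + z ^ 2 + 2 * q * x * cos t)) :
    2 * x * h = -α * S ∧ h * (q ^ 2 + x ^ 2 + z ^ 2) = α * (z * C - x * S) := by
  have h₂ := heq (π / 2)
  have h₃ := heq (π / 3)
  rw [cos_pi_div_two] at h₂
  rw [cos_pi_div_three] at h₃
  have hD₂ : q ^ 2 + x ^ 2 + z ^ 2 + 2 * q * x * 0 ≠ 0 := by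
    rw [mul_zero, add_zero]
    positivity
  have hD₃ : q ^ 2 + x ^ 2 + z ^ 2 + 2 * q * x * (1 / 2) ≠ 0 := by
    have : 0 < x ^ 2 := by positivity
    nlinarith [sq_nonneg (q + x / 2), sq_nonneg z]
  have e₂ := (eq_div_iff hD₂).1 (h₂ hD₂)
  have e₃ := (eq_div_iff hD₃).1 (h₃ hD₃)
  refine ⟨mul_left_cancel₀ hq ?_, ?_⟩
  · linear_combination 2 * e₃ - 2 * e₂
  · linear_combination e₂

/-- If a rotational surface about the axis `{x = q₁, y = 0}`, with arc-length
generating curve `(q₁ + x(s), 0, z(s))` and angle function `ψ` (`x' = cos ψ`, `z' = sin ψ`),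
is `α`-stationary, then either the axis passes through the origin (`q₁ = 0`), or `z ≡ 0`,
or `α = −4` and the generating curve lies on a circle `x² + (z − c)² = q₁² + c²`. -/
theorem rotation_axis_through_origin (α : ℝ) (hα : α ≠ 0) (q₁ : ℝ) (a b : ℝ) (hab : a < b)
    (x z ψ ψ' : ℝ → ℝ)
    (hx : ∀ s ∈ Ioo a b, 0 < x s)
    (hx' : ∀ s ∈ Ioo a b, HasDerivAt x (cos (ψ s)) s)
    (hz' : ∀ s ∈ Ioo a b, HasDerivAt z (sin (ψ s)) s)
    (hψ' : ∀ s ∈ Ioo a b, HasDerivAt ψ (ψ' s) s)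
    (heq : ∀ s ∈ Ioo a b, ∀ t : ℝ,
      q₁ ^ 2 + x s ^ 2 + z s ^ 2 + 2 * q₁ * x s * cos t ≠ 0 →
      ψ' s + sin (ψ s) / x s =
        α * (z s * cos (ψ s) - sin (ψ s) * (q₁ * cos t + x s)) /
          (q₁ ^ 2 + x s ^ 2 + z s ^ 2 + 2 * q₁ * x s * cos t)) :
    q₁ = 0 ∨ (∀ s ∈ Ioo a b, z s = 0) ∨
      (α = -4 ∧ ∃ c : ℝ, ∀ s ∈ Ioo a b, x s ^ 2 + (z s - c) ^ 2 = q₁ ^ 2 + c ^ 2) := by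
  refine or_iff_not_imp_left.2 fun hq => ?_
  have hcoef := fun s hs => stationary_coefficients hq (hx s hs) (heq s hs)
  have hψx : ∀ s ∈ Ioo a b, x s * ψ' s = -(α / 2 + 1) * sin (ψ s) := fun s hs => by
    have h := (hcoef s hs).1
    have hx0 := (hx s hs).ne'
    field_simp at h
    linear_combination h / 2
  have hA : ∀ s ∈ Ioo a b,
      2 * x s * z s * cos (ψ s) + sin (ψ s) * (q₁ ^ 2 + z s ^ 2 - x s ^ 2) = 0 := fun s hs => by
    obtain ⟨h₁, h₂⟩ := hcoef s hs
    refine mul_left_cancel₀ hα ?_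
    linear_combination (q₁ ^ 2 + x s ^ 2 + z s ^ 2) * h₁ - 2 * x s * h₂
  have hz_of_sin : ∀ s ∈ Ioo a b, sin (ψ s) = 0 → z s = 0 := fun s hs h => by
    have h₁ := hA s hs
    have h₂ := sin_sq_add_cos_sq (ψ s)
    have hc : cos (ψ s) ≠ 0 := fun hc => by simp [h, hc] at h₂
    simpa [h, hc, (hx s hs).ne'] using h₁
  have hkey : ∀ s ∈ Ioo a b, (α + 4) * (z s * sin (ψ s)) = 0 := fun s hs => by
    have hd := (((((hx' s hs).const_mul 2).mul (hz' s hs)).mul (hψ' s hs).cos)).add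
      ((hψ' s hs).sin.mul ((((hz' s hs).pow 2).const_add (q₁ ^ 2)).sub ((hx' s hs).pow 2)))
    have h0 := hd.unique ((hasDerivAt_const s (0 : ℝ)).congr_of_eventuallyEq
      (Filter.eventuallyEq_of_mem (isOpen_Ioo.mem_nhds hs) fun u hu => by simpa using hA u hu))
    simp only [Nat.cast_ofNat, Nat.add_one_sub_one, pow_one, Pi.pow_apply, Pi.mul_apply,
      Pi.sub_apply] at h0
    linear_combination sin (ψ s) * h0 - ψ' s * cos (ψ s) * hA s hs
      - (2 * z s * sin (ψ s) - 2 * x s * z s * ψ' s) * sin_sq_add_cos_sq (ψ s)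
      + 2 * z s * hψx s hs
  by_cases hα4 : α = -4
  · subst hα4
    obtain ⟨s₀, hs₀⟩ := nonempty_Ioo.2 hab
    have hψk : ∀ s ∈ Ioo a b, x s * ψ' s = sin (ψ s) := fun s hs => by
      linear_combination hψx s hs
    set k := sin (ψ s₀) / x s₀
    have hk : ∀ s ∈ Ioo a b, sin (ψ s) = k * x s := fun s hs => by
      rw [← div_eq_iff (hx s hs).ne']
      refine eq_of_hasDerivAt_zero_on_Ioo (f := fun u => sin (ψ u) / x u) (fun u hu => ?_) hs hs₀
      refine ((hψ' u hu).sin.div (hx' u hu) (hx u hu).ne').congr_deriv ?_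
      rw [div_eq_zero_iff]
      left
      linear_combination cos (ψ u) * hψk u hu
    by_cases hk0 : k = 0
    · exact Or.inl fun s hs => hz_of_sin s hs (by rw [hk s hs, hk0, zero_mul])
    set m := cos (ψ s₀) + k * z s₀
    have hm : ∀ s ∈ Ioo a b, cos (ψ s) + k * z s = m := fun s hs => by
      refine eq_of_hasDerivAt_zero_on_Ioo (f := fun u => cos (ψ u) + k * z u)
        (fun u hu => ?_) hs hs₀
      refine ((hψ' u hu).cos.add ((hz' u hu).const_mul k)).congr_deriv ?_
      have hψ'k : ψ' u = k := mul_left_cancel₀ (hx u hu).ne' (by rw [hψk u hu, hk u hu, mul_comm])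
      rw [hψ'k]
      ring
    refine Or.inr ⟨rfl, m / k, fun s hs => ?_⟩
    have h₁ := hA s hs
    rw [hk s hs] at h₁
    have h₂ : 2 * z s * cos (ψ s) + k * (q₁ ^ 2 + z s ^ 2 - x s ^ 2) = 0 :=
      mul_left_cancel₀ (hx s hs).ne' (by linear_combination h₁)
    field_simp
    linear_combination -k * h₂ + 2 * k * z s * hm s hs
  · have hzsin : ∀ s ∈ Ioo a b, z s * sin (ψ s) = 0 := fun s hs =>
      (mul_eq_zero.1 (hkey s hs)).resolve_left fun h => hα4 (by linarith)
    refine Or.inl fun s hs => by_contra fun hz => ?_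
    exact hz (hz_of_sin s hs ((mul_eq_zero.1 (hzsin s hs)).resolve_left hz))
end

section
/- For every α ∈ ℝ and every u₀ > 0 there exist R > 0 and a function u : [0, R] → ℝ of class C² with u(0) = u₀, u'(0) = 0, u(r) > 0 for all r ∈ [0, R], and such that for all r ∈ (0, R]: u''(r)/(1 + u'(r)²)^{3/2} + u'(r)/(r·√(1 + u'(r)²)) = α·(u(r) − r·u'(r))/((r² + u(r)²)·√(1 + u'(r)²)). -/
open Real Set Filter Topology BoundedContinuousFunction

/-- A `C¹` function that does not depend on its last argument along the slice through the base
point is Lipschitz near that point, with an arbitrarily small constant in the last argument. -/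
lemma exists_closedBall_dist_le_of_const_slice {G : ℝ × ℝ × ℝ → ℝ} {u₀ w₀ : ℝ}
    (hG : ContDiffAt ℝ 1 G (0, u₀, w₀)) (hslice : ∀ w, G (0, u₀, w) = 2 * w₀) {ε : ℝ}
    (hε : 0 < ε) :
    ∃ δ L : ℝ, 0 < δ ∧ δ ≤ ε ∧ 0 ≤ L ∧
      ∀ x ∈ Metric.closedBall ((0, u₀, w₀) : ℝ × ℝ × ℝ) δ,
      ∀ y ∈ Metric.closedBall ((0, u₀, w₀) : ℝ × ℝ × ℝ) δ,
        |G x - G y| ≤ L * (|x.1 - y.1| + |x.2.1 - y.2.1|) + 1 / 2 * ‖x - y‖ := by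
  have hs := hG.hasStrictFDerivAt one_ne_zero
  set A := fderiv ℝ G (0, u₀, w₀)
  have hA : A (0, 0, 1) = 0 := by
    have h1 : HasDerivAt (fun w : ℝ => ((0, u₀, w) : ℝ × ℝ × ℝ)) (0, 0, 1) w₀ :=
      (hasDerivAt_const _ _).prodMk ((hasDerivAt_const _ _).prodMk (hasDerivAt_id _))
    have h2 := hs.hasFDerivAt.comp_hasDerivAt w₀ h1
    have h3 : (G ∘ fun w : ℝ => ((0, u₀, w) : ℝ × ℝ × ℝ)) = fun _ => 2 * w₀ :=
      funext hslice
    rw [h3] at h2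
    exact h2.unique (hasDerivAt_const _ _)
  have hAapp : ∀ z : ℝ × ℝ × ℝ, A z = z.1 * A (1, 0, 0) + z.2.1 * A (0, 1, 0) := by
    intro z
    have : z = z.1 • ((1, 0, 0) : ℝ × ℝ × ℝ) + z.2.1 • ((0, 1, 0) : ℝ × ℝ × ℝ)
        + z.2.2 • ((0, 0, 1) : ℝ × ℝ × ℝ) := by
      ext <;> simp
    conv_lhs => rw [this]
    simp only [map_add, map_smul, hA, smul_eq_mul]
    ring
  have hev := hs.isLittleO.def (show (0 : ℝ) < 1 / 2 by norm_num)
  obtain ⟨δ₀, hδ₀, hball⟩ := Metric.eventually_nhds_iff_ball.1 hev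
  refine ⟨min ε (δ₀ / 2), |A (1, 0, 0)| + |A (0, 1, 0)|, by positivity, min_le_left _ _,
    by positivity, fun x hx y hy => ?_⟩
  have hlt : min ε (δ₀ / 2) < δ₀ := (min_le_right _ _).trans_lt (by linarith)
  have hxy := hball (x, y) (by
    rw [Metric.mem_closedBall] at hx hy
    rw [Metric.mem_ball, Prod.dist_eq]
    exact max_lt (hx.trans_lt hlt) (hy.trans_lt hlt))
  simp only [Real.norm_eq_abs] at hxy
  have hAxy : |A (x - y)| ≤
      (|A (1, 0, 0)| + |A (0, 1, 0)|) * (|x.1 - y.1| + |x.2.1 - y.2.1|) := by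
    rw [hAapp]
    refine (abs_add_le _ _).trans ?_
    simp only [abs_mul, Prod.fst_sub, Prod.snd_sub]
    nlinarith [mul_nonneg (abs_nonneg (x.1 - y.1)) (abs_nonneg (A (0, 1, 0))),
      mul_nonneg (abs_nonneg (x.2.1 - y.2.1)) (abs_nonneg (A (1, 0, 0)))]
  have := abs_add_le (G x - G y - A (x - y)) (A (x - y))
  rw [sub_add_cancel] at this
  linarith

/-- Bound on an integral against the weight `s` on `[0, 1]`. -/
lemma abs_integral_mul_le {h : ℝ → ℝ} {M : ℝ} (hM : ∀ s, |h s| ≤ M) :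
    |∫ s in (0 : ℝ)..1, s * h s| ≤ M := by
  have := intervalIntegral.norm_integral_le_of_norm_le_const (a := 0) (b := 1)
    (f := fun s : ℝ => s * h s) (C := M) (by
      intro s hs
      rw [uIoc_of_le zero_le_one] at hs
      rw [norm_mul, Real.norm_eq_abs, Real.norm_eq_abs, abs_of_pos hs.1]
      nlinarith [hM s, abs_nonneg (h s), hs.1, hs.2])
  simpa using this

/-- Bound on an integral against the weight `s` on `[0, r]` with `r ≤ R ≤ 1`. -/
lemma abs_integral_id_mul_le {h : ℝ → ℝ} {M R : ℝ} (hM : ∀ s, |h s| ≤ M) (hR : R ≤ 1)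
    {r : ℝ} (hr : r ∈ Icc 0 R) :
    |∫ s in (0 : ℝ)..r, s * h s| ≤ R * M := by
  have hM0 : 0 ≤ M := (abs_nonneg _).trans (hM 0)
  have := intervalIntegral.norm_integral_le_of_norm_le_const (a := 0) (b := r)
    (f := fun s : ℝ => s * h s) (C := M) (by
      intro s hs
      rw [uIoc_of_le hr.1] at hs
      rw [norm_mul, Real.norm_eq_abs, Real.norm_eq_abs, abs_of_pos hs.1]
      nlinarith [hM s, abs_nonneg (h s), hs.1, hs.2, hr.2])
  rw [sub_zero, abs_of_nonneg hr.1, Real.norm_eq_abs] at this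
  nlinarith [hr.2]

lemma integral_id_mul_sub_integral_id_mul {f h : ℝ → ℝ} (hf : Continuous f) (hh : Continuous h)
    (a b : ℝ) :
    (∫ s in a..b, s * f s) - ∫ s in a..b, s * h s = ∫ s in a..b, s * (f s - h s) := by
  simp only [mul_sub]
  exact (intervalIntegral.integral_sub ((continuous_id.mul hf).intervalIntegrable _ _)
    ((continuous_id.mul hh).intervalIntegrable _ _)).symm

/-- The function `r ↦ r * ∫₀¹ s g(r s) ds`, which solves `v' + v / r = g`, is differentiable
everywhere, the origin included. -/
lemma hasDerivAt_mul_integral_mul_comp {g w : ℝ → ℝ} (hg : Continuous g) (hw : Continuous w)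
    (h : ∀ r, w r = ∫ s in (0 : ℝ)..1, s * g (r * s)) (r : ℝ) :
    HasDerivAt (fun r => r * w r) (g r - w r) r := by
  rcases eq_or_ne r 0 with rfl | hr
  · have h0 : g 0 - w 0 = w 0 := by
      rw [h 0]
      simp only [zero_mul, intervalIntegral.integral_mul_const, integral_id]
      ring
    rw [h0, hasDerivAt_iff_tendsto_slope]
    refine (hw.tendsto 0 |>.mono_left nhdsWithin_le_nhds).congr' ?_
    filter_upwards [self_mem_nhdsWithin] with x hx
    have hx : x ≠ 0 := hx
    simp [slope_def_field, hx]
  · have hsq : ∀ x : ℝ, x ≠ 0 → x * w x = (∫ t in (0 : ℝ)..x, t * g t) / x := by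
      intro x hx
      have := intervalIntegral.smul_integral_comp_mul_left
        (a := 0) (b := 1) (fun t : ℝ => t * g t) x
      simp only [mul_zero, mul_one, smul_eq_mul] at this
      rw [← this, h x, mul_div_cancel_left₀ _ hx, ← intervalIntegral.integral_const_mul]
      simp only [mul_assoc]
    have hI : HasDerivAt (fun x => ∫ t in (0 : ℝ)..x, t * g t) (r * g r) r :=
      (continuous_id.mul hg).integral_hasStrictDerivAt 0 r |>.hasDerivAt
    have hq := hI.div (hasDerivAt_id r) hr
    have hval : (r * g r * id r - (∫ t in (0 : ℝ)..r, t * g t) * 1) / id r ^ 2 = g r - w r := by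
      have := hsq r hr
      rw [eq_div_iff hr] at this
      simp only [id]
      rw [← this]
      field_simp
    rw [hval] at hq
    refine hq.congr_of_eventuallyEq ?_
    filter_upwards [isOpen_ne.mem_nhds hr] with x hx
    simpa using hsq x hx

/-- Local solvability of the singular initial value problem `(r u')' = r G(r, u, u'/r)`,
`u(0) = u₀`, `u'(0) = 0`, where `w = u'/r`. -/
theorem exists_solution_singular_ivp {G : ℝ × ℝ × ℝ → ℝ} {u₀ w₀ : ℝ}
    (hG : ContDiffAt ℝ 1 G (0, u₀, w₀)) (hslice : ∀ w, G (0, u₀, w) = 2 * w₀) {ε : ℝ}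
    (hε : 0 < ε) :
    ∃ R : ℝ, 0 < R ∧ ∃ u w g : ℝ → ℝ, Continuous w ∧ Continuous g ∧ u 0 = u₀ ∧
      (∀ r, HasDerivAt u (r * w r) r) ∧
      (∀ r, HasDerivAt (fun r => r * w r) (g r - w r) r) ∧
      ∀ r ∈ Icc 0 R, |u r - u₀| ≤ ε ∧ g r = G (r, u r, w r) := by
  obtain ⟨δ, L, hδ, hδε, hL, hLip⟩ := exists_closedBall_dist_le_of_const_slice hG hslice hε
  obtain ⟨R, hR, hR1, hRδ, hRu, hRmap, hRL⟩ : ∃ R : ℝ, 0 < R ∧ R ≤ 1 ∧ R ≤ δ ∧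
      R * (|w₀| + δ) ≤ δ ∧ L * (R + R * (|w₀| + δ)) ≤ δ / 2 ∧ L * R ≤ 1 / 4 := by
    have key : ∀ f : ℝ → ℝ, Continuous f → f 0 = 0 → ∀ c > 0, ∀ᶠ R in 𝓝[>] (0 : ℝ), f R ≤ c := by
      intro f hf h0 c hc
      have : ∀ᶠ R in 𝓝 (0 : ℝ), f R < c := hf.continuousAt.eventually_lt_const (by rwa [h0])
      exact (this.filter_mono nhdsWithin_le_nhds).mono fun _ => le_of_lt
    have := (eventually_mem_nhdsWithin (a := (0 : ℝ)) (s := Ioi 0)).and <|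
      (key (fun R => R) (by fun_prop) rfl 1 one_pos).and <|
      (key (fun R => R) (by fun_prop) rfl δ hδ).and <|
      (key (fun R => R * (|w₀| + δ)) (by fun_prop) (by simp) δ hδ).and <|
      (key (fun R => L * (R + R * (|w₀| + δ))) (by fun_prop) (by simp) (δ / 2) (by linarith)).and <|
      key (fun R => L * R) (by fun_prop) (by simp) (1 / 4) (by norm_num)
    exact this.exists
  set B : Set (ℝ →ᵇ ℝ) := Metric.closedBall (BoundedContinuousFunction.const ℝ w₀) δ with hB
  let c : ℝ → ℝ := fun r => max 0 (min R r)
  have hc : Continuous c := by fun_prop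
  have hcmem : ∀ r, c r ∈ Icc 0 R := fun r => ⟨le_max_left _ _, max_le hR.le (min_le_left _ _)⟩
  have hcid : ∀ r ∈ Icc 0 R, c r = r := fun r hr => by
    simp only [c]; rw [min_eq_right hr.2, max_eq_right hr.1]
  let U : (ℝ →ᵇ ℝ) → ℝ → ℝ := fun w r => u₀ + ∫ s in (0 : ℝ)..r, s * w s
  have hUderiv : ∀ w r, HasDerivAt (U w) (r * w r) r := fun w r =>
    ((continuous_id.mul w.continuous).integral_hasStrictDerivAt 0 r).hasDerivAt.const_add u₀
  have hUcont : ∀ w, Continuous (U w) := fun w =>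
    continuous_iff_continuousAt.2 fun r => (hUderiv w r).continuousAt
  let P : (ℝ →ᵇ ℝ) → ℝ → ℝ × ℝ × ℝ := fun w r => (c r, U w (c r), w (c r))
  have hPcont : ∀ w, Continuous (P w) := fun w =>
    hc.prodMk (((hUcont w).comp hc).prodMk (w.continuous.comp hc))
  have hwB : ∀ w ∈ B, ∀ r, |w r - w₀| ≤ δ := fun w hw r => by
    have := (BoundedContinuousFunction.dist_coe_le_dist r).trans (Metric.mem_closedBall.1 hw)
    simpa [Real.dist_eq] using this
  have hUB : ∀ w ∈ B, ∀ r ∈ Icc 0 R, |U w r - u₀| ≤ R * (|w₀| + δ) := fun w hw r hr => by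
    simp only [U, add_sub_cancel_left]
    refine abs_integral_id_mul_le (fun s => ?_) hR1 hr
    have h1 := abs_add_le (w s - w₀) w₀
    rw [sub_add_cancel] at h1
    linarith [hwB w hw s]
  have hUdiff : ∀ w₁ w₂ : ℝ →ᵇ ℝ, ∀ r ∈ Icc 0 R, |U w₁ r - U w₂ r| ≤ R * dist w₁ w₂ := by
    intro w₁ w₂ r hr
    simp only [U, add_sub_add_left_eq_sub]
    rw [integral_id_mul_sub_integral_id_mul w₁.continuous w₂.continuous]
    exact abs_integral_id_mul_le
      (fun s => by rw [← Real.dist_eq]; exact BoundedContinuousFunction.dist_coe_le_dist s) hR1 hr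
  have hPB : ∀ w ∈ B, ∀ r, P w r ∈ Metric.closedBall ((0, u₀, w₀) : ℝ × ℝ × ℝ) δ := by
    intro w hw r
    simp only [P, Metric.mem_closedBall, Prod.dist_eq, Real.dist_eq, sub_zero]
    refine max_le ?_ (max_le ((hUB w hw _ (hcmem r)).trans hRu) (hwB w hw _))
    rw [abs_of_nonneg (hcmem r).1]
    exact (hcmem r).2.trans hRδ
  have hGcont : ContinuousOn G (Metric.closedBall ((0, u₀, w₀) : ℝ × ℝ × ℝ) δ) := by
    refine (LipschitzOnWith.of_dist_le_mul (K := ⟨2 * L + 1 / 2, by positivity⟩) ?_).continuousOn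
    intro x hx y hy
    have h1 : |x.1 - y.1| ≤ ‖x - y‖ := norm_fst_le (x - y)
    have h2 : |x.2.1 - y.2.1| ≤ ‖x - y‖ := (norm_fst_le (x - y).2).trans (norm_snd_le (x - y))
    rw [Real.dist_eq, dist_eq_norm]
    refine (hLip x hx y hy).trans ?_
    change _ ≤ (2 * L + 1 / 2) * ‖x - y‖
    nlinarith
  have hgcont : ∀ w ∈ B, Continuous fun r => G (P w r) := fun w hw =>
    hGcont.comp_continuous (hPcont w) (hPB w hw)
  have hgbound : ∀ w ∈ B, ∀ r, |G (P w r) - 2 * w₀| ≤ δ := by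
    intro w hw r
    have h0 : ((0, u₀, w₀) : ℝ × ℝ × ℝ) ∈ Metric.closedBall ((0, u₀, w₀) : ℝ × ℝ × ℝ) δ :=
      Metric.mem_closedBall_self hδ.le
    have h1 := hLip _ (hPB w hw r) _ h0
    rw [hslice] at h1
    have h2 := hPB w hw r
    rw [Metric.mem_closedBall, dist_eq_norm] at h2
    have h3 : |(P w r).1 - 0| + |(P w r).2.1 - u₀| ≤ R + R * (|w₀| + δ) := by
      refine add_le_add ?_ (hUB w hw _ (hcmem r))
      rw [sub_zero, abs_of_nonneg (hcmem r).1]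
      exact (hcmem r).2
    have h4 := mul_le_mul_of_nonneg_left h3 hL
    simp only at h1
    linarith
  have hgdiff : ∀ w₁ ∈ B, ∀ w₂ ∈ B, ∀ r,
      |G (P w₁ r) - G (P w₂ r)| ≤ 3 / 4 * dist w₁ w₂ := by
    intro w₁ h₁ w₂ h₂ r
    have h := hLip _ (hPB w₁ h₁ r) _ (hPB w₂ h₂ r)
    have hU := hUdiff w₁ w₂ _ (hcmem r)
    have hd : 0 ≤ dist w₁ w₂ := dist_nonneg
    have hn : ‖P w₁ r - P w₂ r‖ ≤ dist w₁ w₂ := by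
      rw [← dist_eq_norm]
      simp only [P, Prod.dist_eq, dist_self]
      refine max_le hd (max_le ?_ (BoundedContinuousFunction.dist_coe_le_dist _))
      rw [Real.dist_eq]
      nlinarith
    simp only [P, sub_self, abs_zero, zero_add] at h hn ⊢
    have h4 := mul_le_mul_of_nonneg_left hU hL
    nlinarith
  have hTex : ∀ w : B, ∃ v : B, ∀ r, v.1 r = ∫ s in (0 : ℝ)..1, s * G (P w (r * s)) := by
    rintro ⟨w, hw⟩
    have hcont : Continuous fun r => ∫ s in (0 : ℝ)..1, s * G (P w (r * s)) := by
      refine intervalIntegral.continuous_parametric_intervalIntegral_of_continuous' ?_ _ _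
      exact continuous_snd.mul ((hgcont w hw).comp (continuous_fst.mul continuous_snd))
    have hdist : ∀ r, |(∫ s in (0 : ℝ)..1, s * G (P w (r * s))) - w₀| ≤ δ := by
      intro r
      have hw₀ : w₀ = ∫ s in (0 : ℝ)..1, s * (2 * w₀) := by
        rw [intervalIntegral.integral_mul_const, integral_id]; ring
      have hsub := integral_id_mul_sub_integral_id_mul
        ((hgcont w hw).comp (continuous_const_mul r)) (continuous_const (y := 2 * w₀)) 0 1
      rw [← hw₀] at hsub
      exact (congrArg abs hsub).trans_le (abs_integral_mul_le fun s => hgbound w hw _)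
    refine ⟨⟨BoundedContinuousFunction.ofNormedAddCommGroup _ hcont (δ + |w₀|) fun r => ?_, ?_⟩,
      fun r => rfl⟩
    · have h1 := abs_add_le ((∫ s in (0 : ℝ)..1, s * G (P w (r * s))) - w₀) w₀
      rw [sub_add_cancel] at h1
      rw [Real.norm_eq_abs]
      linarith [hdist r]
    · rw [hB, Metric.mem_closedBall, BoundedContinuousFunction.dist_le hδ.le]
      intro r
      simpa [Real.dist_eq] using hdist r
  choose T hT using hTex
  have hTc : ContractingWith (3 / 4) T := by
    refine ⟨by rw [← NNReal.coe_lt_coe]; norm_num, LipschitzWith.of_dist_le_mul fun w₁ w₂ => ?_⟩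
    rw [Subtype.dist_eq, Subtype.dist_eq, BoundedContinuousFunction.dist_le (by positivity)]
    intro r
    rw [Real.dist_eq, hT, hT]
    have hsub := integral_id_mul_sub_integral_id_mul
      ((hgcont w₁ w₁.2).comp (continuous_const_mul r))
      ((hgcont w₂ w₂.2).comp (continuous_const_mul r)) 0 1
    refine (congrArg abs hsub).trans_le (abs_integral_mul_le fun s => ?_)
    simpa using hgdiff w₁ w₁.2 w₂ w₂.2 (r * s)
  have : CompleteSpace B := Metric.isClosed_closedBall.completeSpace_coe
  have : Nonempty B := ⟨⟨_, Metric.mem_closedBall_self hδ.le⟩⟩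
  obtain ⟨⟨w, hw⟩, hfix⟩ : ∃ w : B, T w = w := ⟨_, hTc.fixedPoint_isFixedPt⟩
  have hweq : ∀ r, w r = ∫ s in (0 : ℝ)..1, s * G (P w (r * s)) := fun r => by
    have := hT ⟨w, hw⟩ r
    rwa [hfix] at this
  refine ⟨R, hR, U w, w, fun r => G (P w r), w.continuous, hgcont w hw, by simp [U], hUderiv w,
    hasDerivAt_mul_integral_mul_comp (hgcont w hw) w.continuous hweq, fun r hr => ⟨?_, ?_⟩⟩
  · exact (hUB w hw r hr).trans (hRu.trans hδε)
  · simp only [P, hcid r hr]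

/-- Existence, Thm. 4.1: for every `α` and `u₀ > 0` there is a `C²` solution
`u` on `[0, R]` of the radial stationary equation with `u(0) = u₀`, `u'(0) = 0`, `u > 0`. -/
theorem existence_axisymmetric_solution (α : ℝ) (u₀ : ℝ) (hu₀ : 0 < u₀) :
    ∃ R : ℝ, 0 < R ∧ ∃ u u' u'' : ℝ → ℝ,
      (∀ r ∈ Icc (0:ℝ) R, HasDerivWithinAt u (u' r) (Icc 0 R) r) ∧
      (∀ r ∈ Icc (0:ℝ) R, HasDerivWithinAt u' (u'' r) (Icc 0 R) r) ∧
      ContinuousOn u'' (Icc 0 R) ∧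
      u 0 = u₀ ∧ u' 0 = 0 ∧
      (∀ r ∈ Icc (0:ℝ) R, 0 < u r) ∧
      (∀ r ∈ Ioc (0:ℝ) R,
        u'' r / (1 + u' r ^ 2) ^ ((3:ℝ)/2) + u' r / (r * sqrt (1 + u' r ^ 2)) =
          α * (u r - r * u' r) / ((r ^ 2 + u r ^ 2) * sqrt (1 + u' r ^ 2))) := by
  let G : ℝ × ℝ × ℝ → ℝ := fun x => -(x.1 ^ 2 * x.2.2 ^ 3) +
    α * (x.2.1 - x.1 ^ 2 * x.2.2) * (1 + x.1 ^ 2 * x.2.2 ^ 2) / (x.1 ^ 2 + x.2.1 ^ 2)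
  have hG : ContDiffAt ℝ 1 G (0, u₀, α / (2 * u₀)) := by
    refine ContDiffAt.add (by fun_prop) (ContDiffAt.div (by fun_prop) (by fun_prop) ?_)
    simp [hu₀.ne']
  have hslice : ∀ w, G (0, u₀, w) = 2 * (α / (2 * u₀)) := by
    intro w
    simp only [G]
    field_simp
    ring
  obtain ⟨R, hR, u, w, g, hw, hg, hu0, hu, hv, hsol⟩ :=
    exists_solution_singular_ivp hG hslice (half_pos hu₀)
  have hpos : ∀ r ∈ Icc (0 : ℝ) R, 0 < u r := fun r hr => by
    have := abs_le.1 (hsol r hr).1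
    linarith
  refine ⟨R, hR, u, fun r => r * w r, fun r => g r - w r, fun r _ => (hu r).hasDerivWithinAt,
    fun r _ => (hv r).hasDerivWithinAt, (hg.sub hw).continuousOn, hu0, by simp, hpos, ?_⟩
  intro r hr
  have hr0 : 0 < r := hr.1
  have hur := hpos r (Ioc_subset_Icc_self hr)
  have hQ : 0 < 1 + (r * w r) ^ 2 := by positivity
  have hpow : (1 + (r * w r) ^ 2) ^ ((3 : ℝ) / 2) =
      (1 + (r * w r) ^ 2) * √(1 + (r * w r) ^ 2) := by
    rw [Real.sqrt_eq_rpow, show (3 : ℝ) / 2 = 1 + 1 / 2 by norm_num, Real.rpow_add hQ,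
      Real.rpow_one]
  have hS : 0 < √(1 + (r * w r) ^ 2) := Real.sqrt_pos.2 hQ
  have hD : 0 < r ^ 2 + u r ^ 2 := by positivity
  simp only [(hsol r (Ioc_subset_Icc_self hr)).2, hpow, G]
  generalize √(1 + (r * w r) ^ 2) = S at *
  field_simp
  ring
end

section
/- Let α ∈ ℝ, u₀ > 0, R > 0 and let u : [0, R] → ℝ be of class C² with u(0) = u₀, u'(0) = 0, u > 0 on [0, R], satisfying for all r ∈ (0, R]: u''(r)/(1 + u'(r)²)^{3/2} + u'(r)/(r·√(1 + u'(r)²)) = α·(u(r) − r·u'(r))/((r² + u(r)²)·√(1 + u'(r)²)). Then u''(0) = α/(2u₀). -/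
open Real Set
open Filter Topology

/-- for a `C²` solution `u` on `[0, R]` of the radial stationary equation with
`u(0) = u₀ > 0` and `u'(0) = 0`, one has `u''(0) = α/(2u₀)`. -/
theorem second_derivative_at_axis (α : ℝ) (u₀ : ℝ) (hu₀ : 0 < u₀) (R : ℝ) (hR : 0 < R)
    (u u' u'' : ℝ → ℝ)
    (hu' : ∀ r ∈ Icc (0:ℝ) R, HasDerivWithinAt u (u' r) (Icc 0 R) r)
    (hu'' : ∀ r ∈ Icc (0:ℝ) R, HasDerivWithinAt u' (u'' r) (Icc 0 R) r)
    (hcont : ContinuousOn u'' (Icc 0 R))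
    (h0 : u 0 = u₀) (h0' : u' 0 = 0)
    (hpos : ∀ r ∈ Icc (0:ℝ) R, 0 < u r)
    (heq : ∀ r ∈ Ioc (0:ℝ) R,
      u'' r / (1 + u' r ^ 2) ^ ((3:ℝ)/2) + u' r / (r * sqrt (1 + u' r ^ 2)) =
        α * (u r - r * u' r) / ((r ^ 2 + u r ^ 2) * sqrt (1 + u' r ^ 2))) :
    u'' 0 = α / (2 * u₀) := by
  have h0mem : (0 : ℝ) ∈ Icc 0 R := left_mem_Icc.2 hR.le
  have hle : 𝓝[>] (0 : ℝ) ≤ 𝓝[Icc 0 R] 0 := by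
    rw [← nhdsWithin_Ioc_eq_nhdsGT hR]
    exact nhdsWithin_mono _ Ioc_subset_Icc_self
  have tu : Tendsto u (𝓝[>] 0) (𝓝 u₀) :=
    h0 ▸ (hu' 0 h0mem).continuousWithinAt.tendsto.mono_left hle
  have tu' : Tendsto u' (𝓝[>] 0) (𝓝 0) := by
    simpa only [h0'] using (hu'' 0 h0mem).continuousWithinAt.tendsto.mono_left hle
  have tu'' : Tendsto u'' (𝓝[>] 0) (𝓝 (u'' 0)) := (hcont 0 h0mem).tendsto.mono_left hle
  have tr : Tendsto (fun r : ℝ => r) (𝓝[>] 0) (𝓝 0) := tendsto_id.mono_left nhdsWithin_le_nhds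
  have tslope : Tendsto (fun r => u' r / r) (𝓝[>] 0) (𝓝 (u'' 0)) := by
    have h := hasDerivWithinAt_iff_tendsto_slope.1 (hu'' 0 h0mem)
    rw [Icc_sdiff_left, nhdsWithin_Ioc_eq_nhdsGT hR] at h
    refine h.congr fun r => ?_
    simp [slope_def_field, h0']
  have tone : Tendsto (fun r => 1 + u' r ^ 2) (𝓝[>] 0) (𝓝 1) := by
    simpa using (tu'.pow 2).const_add 1
  have tsqrt : Tendsto (fun r => sqrt (1 + u' r ^ 2)) (𝓝[>] 0) (𝓝 1) := by
    simpa using tone.sqrt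
  have trpow : Tendsto (fun r => (1 + u' r ^ 2) ^ ((3 : ℝ) / 2)) (𝓝[>] 0) (𝓝 1) := by
    simpa using tone.rpow_const (p := (3 : ℝ) / 2) (Or.inl one_ne_zero)
  have tlhs := (tu''.div trpow one_ne_zero).add (tslope.div tsqrt one_ne_zero)
  have trhs := ((tu.sub (tr.mul tu')).const_mul α).div
    (((tr.pow 2).add (tu.pow 2)).mul tsqrt) (by positivity)
  have hlim := tendsto_nhds_unique (tlhs.congr' ?_) trhs
  · have hmul : u₀ * (2 * u₀ * u'' 0) = u₀ * α := by
      field_simp at hlim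
      linarith
    rw [eq_div_iff (by positivity), mul_comm]
    exact mul_left_cancel₀ hu₀.ne' hmul
  · filter_upwards [Ioc_mem_nhdsGT hR] with r hr
    simp only [Pi.div_apply, div_div]
    exact heq r hr
end

section
/- Let α ∈ ℝ, r > 0, and let u : B_r(0) → ℝ be Lipschitz continuous on the open disk B_r(0) ⊂ ℝ², of class C² on the punctured disk B_r(0) \ {0}, with |q|² + u(q)² > 0 for all q ∈ B_r(0), and satisfying the equation (eq-div) pointwise on B_r(0) \ {0}. Then u is a weak solution on the whole disk: for every smooth function φ with compact support contained in B_r(0), ∫_{B_r(0)} ⟨Du, Dφ⟩/√(1+|Du|²) dx dy = α ∫_{B_r(0)} ((⟨q, Du⟩ − u)/((|q|² + u²)√(1+|Du|²)))·φ dx dy. -/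
open Real Set
open scoped RealInnerProductSpace

/-- The divergence of the normalized gradient field `Du/√(1+|Du|²)` of a function
`u : ℝ² → ℝ`, i.e. the left-hand side of equation (eq-div). -/
noncomputable def mcDiv (u : EuclideanSpace ℝ (Fin 2) → ℝ) (q : EuclideanSpace ℝ (Fin 2)) : ℝ :=
  ∑ i : Fin 2,
    fderiv ℝ (fun p => (Real.sqrt (1 + ‖gradient u p‖ ^ 2))⁻¹ • gradient u p) q
      (EuclideanSpace.single i 1) i

open MeasureTheory Filter Topology

/-- The divergence of a vector field on the plane. -/
noncomputable def planeDiv (X : EuclideanSpace ℝ (Fin 2) → EuclideanSpace ℝ (Fin 2))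
    (q : EuclideanSpace ℝ (Fin 2)) : ℝ :=
  ∑ i : Fin 2, fderiv ℝ X q (EuclideanSpace.single i 1) i

theorem integrable_mul_of_tsupport_subset {U : Set (EuclideanSpace ℝ (Fin 2))} (hU : IsOpen U)
    {f h : EuclideanSpace ℝ (Fin 2) → ℝ} (hf : Continuous f) (hc : HasCompactSupport f)
    (hs : tsupport f ⊆ U) (hh : ContinuousOn h U) : Integrable (fun q => f q * h q) := by
  have hsub : tsupport (fun q => f q * h q) ⊆ tsupport f :=
    tsupport_mul_subset_left
  refine Continuous.integrable_of_hasCompactSupport ?_ hc.mul_right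
  exact (hf.continuousOn.mul hh).continuous_of_tsupport_subset hU (hsub.trans hs)

/-- The divergence theorem for a `C¹` vector field times a compactly supported function. -/
theorem integral_fderiv_add_mul_planeDiv {U : Set (EuclideanSpace ℝ (Fin 2))} (hU : IsOpen U)
    {X : EuclideanSpace ℝ (Fin 2) → EuclideanSpace ℝ (Fin 2)} (hX : ContDiffOn ℝ 1 X U)
    {ψ : EuclideanSpace ℝ (Fin 2) → ℝ} (hψ : ContDiff ℝ 1 ψ) (hc : HasCompactSupport ψ)
    (hs : tsupport ψ ⊆ U) :
    Integrable (fun q => fderiv ℝ ψ q (X q) + ψ q * planeDiv X q) ∧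
      ∫ q, (fderiv ℝ ψ q (X q) + ψ q * planeDiv X q) = 0 := by
  have hXi (i : Fin 2) : ContDiffOn ℝ 1 (fun q => X q i) U := contDiffOn_euclidean.1 hX i
  have hXd : ∀ q ∈ U, DifferentiableAt ℝ X q := fun q hq =>
    (hX.differentiableOn (by norm_num)).differentiableAt (hU.mem_nhds hq)
  have hcomp (i : Fin 2) : ∀ q ∈ U, fderiv ℝ (fun p => X p i) q (EuclideanSpace.single i 1) =
      fderiv ℝ X q (EuclideanSpace.single i 1) i := by
    intro q hq
    have := ((EuclideanSpace.proj (𝕜 := ℝ) i).hasFDerivAt.comp q (hXd q hq).hasFDerivAt).fderiv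
    change fderiv ℝ (fun p => X p i) q = _ at this
    rw [this]
    rfl
  have hdψ (i : Fin 2) : Continuous fun q => fderiv ℝ ψ q (EuclideanSpace.single i 1) :=
    (hψ.continuous_fderiv (by norm_num)).clm_apply continuous_const
  have hI1 (i : Fin 2) : Integrable fun q =>
      fderiv ℝ ψ q (EuclideanSpace.single i 1) * X q i :=
    integrable_mul_of_tsupport_subset hU (hdψ i) (hc.fderiv_apply ℝ _)
      ((tsupport_fderiv_apply_subset ℝ _).trans hs) (hXi i).continuousOn
  have hI2 (i : Fin 2) : Integrable fun q =>
      ψ q * fderiv ℝ (fun p => X p i) q (EuclideanSpace.single i 1) :=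
    integrable_mul_of_tsupport_subset hU hψ.continuous hc hs
      (((hXi i).continuousOn_fderiv_of_isOpen hU le_rfl).clm_apply continuousOn_const)
  have hI3 (i : Fin 2) : Integrable fun q => ψ q * X q i :=
    integrable_mul_of_tsupport_subset hU hψ.continuous hc hs (hXi i).continuousOn
  have hparts (i : Fin 2) := integral_mul_fderiv_eq_neg_fderiv_mul_of_integrable
    (hI1 i) (hI2 i) (hI3 i) (fun q _ => (hψ.differentiable (by norm_num)) q)
    (fun q hq => ((hXi i).differentiableOn (by norm_num)).differentiableAt
      (hU.mem_nhds (hs hq)))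
  have heq : (fun q => fderiv ℝ ψ q (X q) + ψ q * planeDiv X q) = fun q => ∑ i : Fin 2,
      (fderiv ℝ ψ q (EuclideanSpace.single i 1) * X q i +
        ψ q * fderiv ℝ (fun p => X p i) q (EuclideanSpace.single i 1)) := by
    ext q
    have h1 : fderiv ℝ ψ q (X q) =
        ∑ i : Fin 2, fderiv ℝ ψ q (EuclideanSpace.single i 1) * X q i := by
      have hdec : X q = ∑ i : Fin 2, X q i • EuclideanSpace.single i (1 : ℝ) := by
        ext j; fin_cases j <;> simp
      conv_lhs => rw [hdec]
      rw [map_sum]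
      simp [mul_comm]
    rw [Finset.sum_add_distrib, h1, planeDiv, Finset.mul_sum]
    congr 1
    refine Finset.sum_congr rfl fun i _ => ?_
    by_cases hq : q ∈ tsupport ψ
    · rw [hcomp i q (hs hq)]
    · simp [image_eq_zero_of_notMem_tsupport hq]
  rw [heq]
  refine ⟨integrable_finsetSum _ fun i _ => (hI1 i).add (hI2 i), ?_⟩
  refine (integral_finsetSum _ fun i _ => (hI1 i).add (hI2 i)).trans ?_
  refine Finset.sum_eq_zero fun i _ => ?_
  refine (integral_add (hI1 i) (hI2 i)).trans ?_
  rw [hparts i]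
  ring

/-- A point is removable for the weak divergence of a bounded planar vector field. -/
theorem integral_fderiv_add_mul_planeDiv_of_punctured {Ω : Set (EuclideanSpace ℝ (Fin 2))}
    (hΩ : IsOpen Ω) {X : EuclideanSpace ℝ (Fin 2) → EuclideanSpace ℝ (Fin 2)}
    (hX : ContDiffOn ℝ 1 X (Ω \ {0})) {C : ℝ} (hC : ∀ q, ‖X q‖ ≤ C)
    {φ : EuclideanSpace ℝ (Fin 2) → ℝ} (hφ : ContDiff ℝ 1 φ) (hc : HasCompactSupport φ)
    (hs : tsupport φ ⊆ Ω)
    (hint : Integrable (fun q => fderiv ℝ φ q (X q) + φ q * planeDiv X q)) :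
    ∫ q, (fderiv ℝ φ q (X q) + φ q * planeDiv X q) = 0 := by
  set G := fun q => fderiv ℝ φ q (X q) + φ q * planeDiv X q with hG
  let f : ContDiffBump (0 : EuclideanSpace ℝ (Fin 2)) := ⟨1, 2, one_pos, one_lt_two⟩
  have hf : ContDiff ℝ 1 f := f.contDiff
  obtain ⟨M, hM⟩ := (hf.continuous_fderiv (by norm_num)).bounded_above_of_compact_support
    (f.hasCompactSupport.fderiv (𝕜 := ℝ))
  obtain ⟨N, hN⟩ := hφ.continuous.bounded_above_of_compact_support hc
  have hC0 : 0 ≤ C := (norm_nonneg _).trans (hC 0)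
  have hM0 : 0 ≤ M := (norm_nonneg _).trans (hM 0)
  have hN0 : 0 ≤ N := (norm_nonneg _).trans (hN 0)
  let η : ℕ → EuclideanSpace ℝ (Fin 2) → ℝ := fun n q => 1 - f (((n : ℝ) + 1) • q)
  have hη (n : ℕ) : ContDiff ℝ 1 (η n) :=
    contDiff_const.sub (hf.comp (contDiff_id.const_smul ((n : ℝ) + 1)))
  have hη_le (n : ℕ) (q) : ‖η n q‖ ≤ 1 := by
    have h0 := f.nonneg (x := ((n : ℝ) + 1) • q)
    have h1 := f.le_one (x := ((n : ℝ) + 1) • q)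
    rw [Real.norm_eq_abs, abs_le]
    constructor <;> simp only [η] <;> linarith
  have hdη (n : ℕ) (q) : fderiv ℝ (η n) q =
      -(((n : ℝ) + 1) • fderiv ℝ f (((n : ℝ) + 1) • q)) := by
    have h1 : HasFDerivAt (fun p : EuclideanSpace ℝ (Fin 2) => ((n : ℝ) + 1) • p)
        (((n : ℝ) + 1) • ContinuousLinearMap.id ℝ _) q :=
      (hasFDerivAt_id (𝕜 := ℝ) q).const_smul ((n : ℝ) + 1)
    have h2 := ((hf.differentiable (by norm_num) (((n : ℝ) + 1) • q)).hasFDerivAt.comp q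
      h1).const_sub 1
    refine h2.fderiv.trans ?_
    ext v
    simp
  have hψs (n : ℕ) : tsupport (fun q => η n q * φ q) ⊆ Ω \ {0} := by
    intro q hq
    refine ⟨hs (tsupport_mul_subset_right hq), ?_⟩
    rintro rfl
    revert hq
    rw [imp_false, notMem_tsupport_iff_eventuallyEq]
    have ht : Tendsto (fun p : EuclideanSpace ℝ (Fin 2) => ((n : ℝ) + 1) • p) (𝓝 0) (𝓝 0) := by
      have : Continuous fun p : EuclideanSpace ℝ (Fin 2) => ((n : ℝ) + 1) • p := by fun_prop
      simpa using this.tendsto 0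
    filter_upwards [ht.eventually f.eventuallyEq_one] with p hp
    simp [η, hp]
  have hU : IsOpen (Ω \ {0}) := hΩ.sdiff isClosed_singleton
  have hmain (n : ℕ) := integral_fderiv_add_mul_planeDiv hU hX ((hη n).mul hφ)
    (hc.mul_left (f := η n)) (hψs n)
  have hsplit (n : ℕ) : (fun q => fderiv ℝ (η n * φ) q (X q) + (η n * φ) q * planeDiv X q) =
      fun q => η n q * G q + φ q * fderiv ℝ (η n) q (X q) := by
    ext q
    rw [fderiv_mul ((hη n).differentiable (by norm_num) q) (hφ.differentiable (by norm_num) q)]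
    simp [hG]
    ring
  have hI1 (n : ℕ) : Integrable fun q => η n q * G q :=
    hint.bdd_mul (hη n).continuous.aestronglyMeasurable (ae_of_all _ (hη_le n))
  have hI2 (n : ℕ) : Integrable fun q => φ q * fderiv ℝ (η n) q (X q) := by
    have h := (hmain n).1
    change Integrable (fun q => fderiv ℝ (η n * φ) q (X q) + (η n * φ) q * planeDiv X q) at h
    rw [hsplit n] at h
    refine (h.sub (hI1 n)).congr (ae_of_all _ fun q => ?_)
    simp
  have hsum (n : ℕ) :
      ∫ q, η n q * G q = - ∫ q, φ q * fderiv ℝ (η n) q (X q) := by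
    have h := (hmain n).2
    change ∫ q, (fderiv ℝ (η n * φ) q (X q) + (η n * φ) q * planeDiv X q) = 0 at h
    rw [hsplit n, integral_add (hI1 n) (hI2 n)] at h
    linarith
  have hlim1 : Tendsto (fun n => ∫ q, η n q * G q) atTop (𝓝 (∫ q, G q)) := by
    refine tendsto_integral_of_dominated_convergence (fun q => ‖G q‖)
      (fun n => (hI1 n).aestronglyMeasurable) hint.norm (fun n => ae_of_all _ fun q => ?_) ?_
    · rw [norm_mul]
      exact mul_le_of_le_one_left (norm_nonneg _) (hη_le n q)
    · filter_upwards [Measure.ae_ne volume (0 : EuclideanSpace ℝ (Fin 2))] with q hq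
      refine tendsto_const_nhds.congr' ?_
      have hq' : 0 < ‖q‖ := norm_pos_iff.2 hq
      obtain ⟨k, hk⟩ := exists_nat_ge (2 / ‖q‖)
      filter_upwards [eventually_ge_atTop k] with n hn
      have hzero : f (((n : ℝ) + 1) • q) = 0 := by
        apply f.zero_of_le_dist
        rw [dist_zero_right, norm_smul, Real.norm_of_nonneg (by positivity)]
        rw [div_le_iff₀ hq'] at hk
        have : (k : ℝ) ≤ n := by exact_mod_cast hn
        change (2 : ℝ) ≤ _
        nlinarith
      simp [η, hzero]
  have hbound (n : ℕ) : ‖∫ q, φ q * fderiv ℝ (η n) q (X q)‖ ≤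
      (4 * N * M * C * volume.real (Metric.ball (0 : EuclideanSpace ℝ (Fin 2)) 1)) *
        (1 / ((n : ℝ) + 1)) := by
    have hn : (0 : ℝ) < (n : ℝ) + 1 := by positivity
    set B := Metric.closedBall (0 : EuclideanSpace ℝ (Fin 2)) (2 / ((n : ℝ) + 1)) with hB
    rw [← setIntegral_eq_integral_of_forall_compl_eq_zero (s := B)]
    · refine (norm_setIntegral_le_of_norm_le_const (C := N * (((n : ℝ) + 1) * M * C))
        measure_closedBall_lt_top fun q _ => ?_).trans (le_of_eq ?_)
      · rw [norm_mul]
        refine mul_le_mul (hN q) ?_ (norm_nonneg _) hN0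
        refine (ContinuousLinearMap.le_opNorm _ _).trans ?_
        refine mul_le_mul ?_ (hC q) (norm_nonneg _) (by positivity)
        rw [hdη, norm_neg, norm_smul, Real.norm_of_nonneg hn.le]
        exact mul_le_mul_of_nonneg_left (hM _) hn.le
      · rw [Measure.addHaar_real_closedBall _ _ (by positivity)]
        simp only [finrank_euclideanSpace, Fintype.card_fin]
        field_simp
        ring
    · intro q hq
      have hlt : 2 < ((n : ℝ) + 1) * ‖q‖ := by
        rw [hB, mem_closedBall_zero_iff, not_le, div_lt_iff₀ hn] at hq
        linarith
      have : fderiv ℝ f (((n : ℝ) + 1) • q) = 0 := by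
        apply fderiv_of_notMem_tsupport
        rw [f.tsupport_eq, mem_closedBall_zero_iff, norm_smul, Real.norm_of_nonneg hn.le, not_le]
        exact hlt
      simp [hdη, this]
  have hlim2 : Tendsto (fun n => ∫ q, φ q * fderiv ℝ (η n) q (X q)) atTop (𝓝 0) := by
    refine squeeze_zero_norm hbound ?_
    simpa using (tendsto_one_div_add_atTop_nhds_zero_nat (𝕜 := ℝ)).const_mul
      (4 * N * M * C * volume.real (Metric.ball (0 : EuclideanSpace ℝ (Fin 2)) 1))
  refine tendsto_nhds_unique hlim1 ?_
  simp_rw [hsum]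
  simpa using hlim2.neg

/-- first part of Thm. 4.2: a Lipschitz solution of (eq-div) on the punctured
disk which is `C²` off the origin is a weak solution on the whole disk. -/
theorem weak_solution_across_singularity (α : ℝ) (r : ℝ) (hr : 0 < r)
    (u : EuclideanSpace ℝ (Fin 2) → ℝ) (K : NNReal)
    (hLip : LipschitzOnWith K u (Metric.ball 0 r))
    (hC2 : ContDiffOn ℝ 2 u (Metric.ball 0 r \ {0}))
    (hpos : ∀ q ∈ Metric.ball (0 : EuclideanSpace ℝ (Fin 2)) r, 0 < ‖q‖ ^ 2 + u q ^ 2)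
    (heq : ∀ q ∈ Metric.ball (0 : EuclideanSpace ℝ (Fin 2)) r \ {0},
      mcDiv u q = α * (u q - ⟪q, gradient u q⟫) /
        ((‖q‖ ^ 2 + u q ^ 2) * Real.sqrt (1 + ‖gradient u q‖ ^ 2))) :
    ∀ φ : EuclideanSpace ℝ (Fin 2) → ℝ, ContDiff ℝ (⊤ : ℕ∞) φ → HasCompactSupport φ →
      tsupport φ ⊆ Metric.ball 0 r →
      ∫ q in Metric.ball (0 : EuclideanSpace ℝ (Fin 2)) r,
          ⟪gradient u q, gradient φ q⟫ / Real.sqrt (1 + ‖gradient u q‖ ^ 2) =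
        α * ∫ q in Metric.ball (0 : EuclideanSpace ℝ (Fin 2)) r,
          ((⟪q, gradient u q⟫ - u q) /
            ((‖q‖ ^ 2 + u q ^ 2) * Real.sqrt (1 + ‖gradient u q‖ ^ 2))) * φ q := by
  intro φ hφ hc hs
  set U : Set (EuclideanSpace ℝ (Fin 2)) := Metric.ball 0 r \ {0} with hUdef
  have hU : IsOpen U := Metric.isOpen_ball.sdiff isClosed_singleton
  have hUae : (U : Set (EuclideanSpace ℝ (Fin 2))) =ᵐ[volume] Metric.ball 0 r :=
    sdiff_null_ae_eq_self (measure_singleton 0)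
  have hUfin : IsFiniteMeasure (volume.restrict U) :=
    ⟨by
      rw [Measure.restrict_congr_set hUae]
      simpa using measure_ball_lt_top (μ := volume) (x := (0 : EuclideanSpace ℝ (Fin 2)))
        (r := r)⟩
  have hUball : U ⊆ Metric.ball 0 r := sdiff_subset
  have hucont : ContinuousOn u (Metric.ball 0 r) := hLip.continuousOn
  have hφ1 : ContDiff ℝ 1 φ := hφ.of_le (by exact_mod_cast le_top)
  have hgrad : ContDiffOn ℝ 1 (gradient u) U :=
    (InnerProductSpace.toDual ℝ (EuclideanSpace ℝ (Fin 2))).symm.contDiff.comp_contDiffOn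
      (hC2.fderiv_of_isOpen hU (by norm_num))
  have hpos1 (q) : 0 < 1 + ‖gradient u q‖ ^ 2 := by positivity
  have hsq (q) : 0 < Real.sqrt (1 + ‖gradient u q‖ ^ 2) := Real.sqrt_pos.2 (hpos1 q)
  have hle (q) : ‖gradient u q‖ ≤ Real.sqrt (1 + ‖gradient u q‖ ^ 2) :=
    Real.le_sqrt_of_sq_le (by linarith)
  have h1le (q) : 1 ≤ Real.sqrt (1 + ‖gradient u q‖ ^ 2) :=
    Real.one_le_sqrt.2 (by linarith [sq_nonneg ‖gradient u q‖])
  have hsqC : ContDiffOn ℝ 1 (fun q => Real.sqrt (1 + ‖gradient u q‖ ^ 2)) U :=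
    (contDiffOn_const.add (hgrad.norm_sq ℝ)).sqrt fun q _ => (hpos1 q).ne'
  set X : EuclideanSpace ℝ (Fin 2) → EuclideanSpace ℝ (Fin 2) :=
    fun p => (Real.sqrt (1 + ‖gradient u p‖ ^ 2))⁻¹ • gradient u p with hXdef
  have hX : ContDiffOn ℝ 1 X U := (hsqC.inv fun q _ => (hsq q).ne').smul hgrad
  have hXle (q) : ‖X q‖ ≤ 1 := by
    rw [hXdef, norm_smul, norm_inv, Real.norm_of_nonneg (hsq q).le, inv_mul_le_iff₀ (hsq q),
      mul_one]
    exact hle q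
  set A : EuclideanSpace ℝ (Fin 2) → ℝ := fun q =>
    ⟪gradient u q, gradient φ q⟫ / Real.sqrt (1 + ‖gradient u q‖ ^ 2) with hAdef
  set B : EuclideanSpace ℝ (Fin 2) → ℝ := fun q => ((⟪q, gradient u q⟫ - u q) /
    ((‖q‖ ^ 2 + u q ^ 2) * Real.sqrt (1 + ‖gradient u q‖ ^ 2))) * φ q with hBdef
  have hAX (q) : A q = fderiv ℝ φ q (X q) := by
    simp only [hAdef, hXdef, map_smul, smul_eq_mul]
    rw [real_inner_comm, inner_gradient_left]
    ring
  have hdφ : Continuous (fderiv ℝ φ) := hφ1.continuous_fderiv (by norm_num)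
  have hAint : IntegrableOn A U := by
    obtain ⟨M, hM⟩ := hdφ.bounded_above_of_compact_support (hc.fderiv (𝕜 := ℝ))
    refine Integrable.of_bound (C := M) ?_ (ae_of_all _ fun q => ?_)
    · refine ContinuousOn.aestronglyMeasurable ?_ hU.measurableSet
      exact (hdφ.continuousOn.clm_apply hX.continuousOn).congr fun q _ => hAX q
    · rw [hAX]
      refine (ContinuousLinearMap.le_opNorm _ _).trans ?_
      exact (mul_le_of_le_one_right (norm_nonneg _) (hXle q)).trans (hM q)
  have hBint : IntegrableOn B U := by
    have hcont : ContinuousOn (fun q => (‖q‖ + ‖u q‖) / (‖q‖ ^ 2 + u q ^ 2) * ‖φ q‖)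
        (tsupport φ) := by
      have hu' := hucont.mono hs
      refine ((continuous_norm.continuousOn.add hu'.norm).div
        ((continuous_norm.pow 2).continuousOn.add (hu'.pow 2)) fun q hq =>
          (hpos q (hs hq)).ne').mul hφ.continuous.norm.continuousOn
    obtain ⟨M, hM⟩ := hc.isCompact.exists_bound_of_continuousOn hcont
    refine Integrable.of_bound (C := max M 0) ?_ ?_
    · refine ContinuousOn.aestronglyMeasurable ?_ hU.measurableSet
      have hu' := hucont.mono hUball
      refine (((continuousOn_id.inner hgrad.continuousOn).sub hu').div
        (((continuous_norm.pow 2).continuousOn.add (hu'.pow 2)).mul hsqC.continuousOn)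
        fun q hq => ?_).mul hφ.continuous.continuousOn
      exact mul_ne_zero (hpos q (hUball hq)).ne' (hsq q).ne'
    · filter_upwards [ae_restrict_mem hU.measurableSet] with q hq
      by_cases hqs : q ∈ tsupport φ
      · refine le_trans ?_ (((le_abs_self _).trans (hM q hqs)).trans (le_max_left _ _))
        have hp := hpos q (hUball hq)
        rw [hBdef]
        simp only [norm_mul, norm_div]
        refine mul_le_mul_of_nonneg_right ?_ (norm_nonneg _)
        rw [Real.norm_of_nonneg hp.le, Real.norm_of_nonneg (hsq q).le, mul_comm, ← div_div]
        refine div_le_div_of_nonneg_right ?_ hp.le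
        rw [div_le_iff₀ (hsq q)]
        refine (norm_sub_le _ _).trans ?_
        rw [add_mul]
        refine add_le_add ((norm_inner_le_norm _ _).trans ?_) ?_
        · exact mul_le_mul_of_nonneg_left (hle q) (norm_nonneg _)
        · exact le_mul_of_one_le_right (norm_nonneg _) (h1le q)
      · simp [hBdef, image_eq_zero_of_notMem_tsupport hqs]
  set G : EuclideanSpace ℝ (Fin 2) → ℝ := fun q =>
    fderiv ℝ φ q (X q) + φ q * planeDiv X q with hGdef
  have hGU : EqOn (fun q => A q - α * B q) G U := by
    intro q hq
    have hdiv : planeDiv X q = _ := heq q hq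
    simp only [hGdef, hAX, hdiv, hBdef]
    ring
  have hGintU : IntegrableOn G U :=
    (integrableOn_congr_fun hGU hU.measurableSet).1 (hAint.sub (hBint.const_mul α))
  have hGzero : ∀ q, q ∉ Metric.ball (0 : EuclideanSpace ℝ (Fin 2)) r → G q = 0 := by
    intro q hq
    have hq' : q ∉ tsupport φ := fun h => hq (hs h)
    simp [hGdef, image_eq_zero_of_notMem_tsupport hq', fderiv_of_notMem_tsupport ℝ hq']
  have hGint : Integrable G := by
    rw [← integrableOn_iff_integrable_of_support_subset
      (s := Metric.ball (0 : EuclideanSpace ℝ (Fin 2)) r)]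
    · exact hGintU.congr_set_ae hUae.symm
    · exact Function.support_subset_iff'.2 hGzero
  have hzero := integral_fderiv_add_mul_planeDiv_of_punctured Metric.isOpen_ball hX hXle hφ1 hc
    hs hGint
  rw [← setIntegral_eq_integral_of_forall_compl_eq_zero hGzero, ← setIntegral_congr_set hUae,
    ← setIntegral_congr_fun hU.measurableSet hGU,
    integral_sub hAint (hBint.const_mul α), integral_const_mul] at hzero
  rw [← setIntegral_congr_set hUae, ← setIntegral_congr_set hUae]
  linarith
end

section
/- Let α > 0 and S > 0. Let x, z, ψ : [0, S) → ℝ be continuous on [0, S), differentiable on (0, S), with x(0) = 0, z(0) = 1, ψ(0) = 0, x(s) > 0 for all s ∈ (0, S), and satisfying for all s ∈ (0, S): x'(s) = cos ψ(s), z'(s) = sin ψ(s), ψ'(s) = α·(z(s)cos ψ(s) − x(s)sin ψ(s))/(x(s)² + z(s)²) − sin ψ(s)/x(s). Then 0 < ψ(s) < π/2 for every s ∈ (0, S); in particular x'(s) = cos ψ(s) > 0 and z'(s) = sin ψ(s) > 0 on (0, S), so the generating curve is a graph over the x-axis and z attains its global minimum exactly at s = 0. -/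
open Real Set

/-- A function bounded below on the left of `a` by `c ≥ f a` takes the value `c` at `a` and has
nonpositive derivative there. -/
theorem HasDerivAt.eq_and_nonpos_of_left_ge {f : ℝ → ℝ} {d a b c : ℝ} (h : HasDerivAt f d a)
    (hb : b < a) (hf : ∀ t ∈ Ioo b a, c ≤ f t) (hc : f a ≤ c) : f a = c ∧ d ≤ 0 := by
  have hev : ∀ᶠ t in nhdsWithin a (Iio a), t ∈ Ioo b a := Ioo_mem_nhdsLT hb
  have heq : f a = c := le_antisymm hc <|
    ge_of_tendsto (h.continuousAt.tendsto.mono_left nhdsWithin_le_nhds) (hev.mono hf)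
  refine ⟨heq, ?_⟩
  have hs : Filter.Tendsto (slope f a) (nhdsWithin a (Iio a)) (nhds d) :=
    (hasDerivAt_iff_tendsto_slope.1 h).mono_left (nhdsWithin_mono a fun t (ht : t < a) => ht.ne)
  refine le_of_tendsto hs (hev.mono fun t ht => ?_)
  rw [slope_def_field, heq]
  exact div_nonpos_of_nonneg_of_nonpos (sub_nonneg.2 (hf t ht)) (sub_nonpos.2 ht.2.le)

/-- A continuous function with positive derivative on `(0, b)` exceeds its value at `0`. -/
theorem lt_of_hasDerivAt_pos {f f' : ℝ → ℝ} {b : ℝ} (hb : 0 < b)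
    (hc : ContinuousOn f (Icc 0 b)) (hd : ∀ t ∈ Ioo 0 b, HasDerivAt f (f' t) t)
    (hp : ∀ t ∈ Ioo 0 b, 0 < f' t) : f 0 < f b := by
  refine strictMonoOn_of_deriv_pos (convex_Icc 0 b) hc (fun t ht => ?_)
    (left_mem_Icc.2 hb.le) (right_mem_Icc.2 hb.le) hb
  rw [interior_Icc] at ht
  rw [(hd t ht).deriv]
  exact hp t ht

/-- Thm. 5.1, case `α > 0`: for a solution of the rotational system (eq2) with
initial conditions `x(0) = 0`, `z(0) = 1`, `ψ(0) = 0`, the angle `ψ` stays in `(0, π/2)`;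
hence `x' > 0`, `z' > 0`, the generating curve is a graph over the `x`-axis and `z` attains
its global minimum exactly at `s = 0`. -/
theorem case_alpha_positive (α : ℝ) (hα : 0 < α) (S : ℝ) (hS : 0 < S)
    (x z ψ : ℝ → ℝ)
    (hxc : ContinuousOn x (Ico 0 S)) (hzc : ContinuousOn z (Ico 0 S))
    (hψc : ContinuousOn ψ (Ico 0 S))
    (hx0 : x 0 = 0) (hz0 : z 0 = 1) (hψ0 : ψ 0 = 0)
    (hxpos : ∀ s ∈ Ioo 0 S, 0 < x s)
    (hx' : ∀ s ∈ Ioo 0 S, HasDerivAt x (cos (ψ s)) s)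
    (hz' : ∀ s ∈ Ioo 0 S, HasDerivAt z (sin (ψ s)) s)
    (hψ' : ∀ s ∈ Ioo 0 S, HasDerivAt ψ
      (α * (z s * cos (ψ s) - x s * sin (ψ s)) / (x s ^ 2 + z s ^ 2) - sin (ψ s) / x s) s) :
    ∀ s ∈ Ioo 0 S,
      (0 < ψ s ∧ ψ s < π / 2) ∧ 0 < cos (ψ s) ∧ 0 < sin (ψ s) ∧ z 0 < z s := by
  have hpi := Real.pi_pos
  have h0S : (0 : ℝ) ∈ Ico 0 S := ⟨le_rfl, hS⟩
  have hz_lt : ∀ s ∈ Ioo 0 S, (∀ t ∈ Ioo 0 s, 0 < ψ t ∧ ψ t < π / 2) → z 0 < z s := by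
    intro s hs h
    refine lt_of_hasDerivAt_pos hs.1 (hzc.mono fun t ht => ⟨ht.1, ht.2.trans_lt hs.2⟩)
      (fun t ht => hz' t ⟨ht.1, ht.2.trans hs.2⟩) fun t ht => ?_
    exact sin_pos_of_pos_of_lt_pi (h t ht).1 (by linarith [(h t ht).2])
  obtain ⟨ε, hε, hsmall⟩ : ∃ ε, 0 < ε ∧ ∀ t ∈ Ioc 0 ε, 0 < ψ t ∧ ψ t < π / 2 := by
    have hg : ContinuousOn (fun t => z t * cos (ψ t) - x t * sin (ψ t)) (Ico 0 S) :=
      (hzc.mul (continuous_cos.comp_continuousOn hψc)).sub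
        (hxc.mul (continuous_sin.comp_continuousOn hψc))
    have h1 : ∀ᶠ t in nhdsWithin 0 (Ico 0 S), 0 < z t * cos (ψ t) - x t * sin (ψ t) :=
      (hg 0 h0S).eventually_const_lt (by simp [hx0, hz0, hψ0])
    have h2 : ∀ᶠ t in nhdsWithin 0 (Ico 0 S), ψ t < π / 2 :=
      (hψc 0 h0S).eventually_lt_const (by rw [hψ0]; linarith)
    have h3 : ∀ᶠ t in nhdsWithin 0 (Ico 0 S), -(π / 2) < ψ t :=
      (hψc 0 h0S).eventually_const_lt (by rw [hψ0]; linarith)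
    have h123 := h1.and (h2.and h3)
    rw [eventually_nhdsWithin_iff, Metric.eventually_nhds_iff] at h123
    obtain ⟨δ, hδ, H⟩ := h123
    have hm : 0 < min δ S := lt_min hδ hS
    have hmδ := min_le_left δ S
    have hmS := min_le_right δ S
    have H' : ∀ t, 0 < t → t ≤ min δ S / 2 →
        0 < z t * cos (ψ t) - x t * sin (ψ t) ∧ ψ t < π / 2 ∧ -(π / 2) < ψ t := by
      intro t ht0 ht
      refine H ?_ ⟨ht0.le, by linarith⟩
      rw [Real.dist_eq, sub_zero, abs_of_pos ht0]
      linarith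
    refine ⟨min δ S / 2, by linarith, fun t ht => ?_⟩
    have htS : t < S := by linarith [ht.2]
    have hw : x 0 * sin (ψ 0) < x t * sin (ψ t) := by
      refine lt_of_hasDerivAt_pos (f := fun t => x t * sin (ψ t)) ht.1
        ((hxc.mul (continuous_sin.comp_continuousOn hψc)).mono
          fun r hr => ⟨hr.1, hr.2.trans_lt htS⟩)
        (fun r hr => (hx' r ⟨hr.1, hr.2.trans htS⟩).mul (hψ' r ⟨hr.1, hr.2.trans htS⟩).sin)
        fun r hr => ?_
      have hxr := hxpos r ⟨hr.1, hr.2.trans htS⟩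
      obtain ⟨hgr, hr2, hr3⟩ := H' r hr.1 (hr.2.le.trans ht.2)
      have hcr := cos_pos_of_mem_Ioo ⟨hr3, hr2⟩
      have hden : 0 < x r ^ 2 + z r ^ 2 := by positivity
      have hpos : 0 < x r * cos (ψ r) *
          (α * (z r * cos (ψ r) - x r * sin (ψ r)) / (x r ^ 2 + z r ^ 2)) := by positivity
      convert hpos using 1
      field_simp
      ring
    rw [hx0, zero_mul] at hw
    have hsin : 0 < sin (ψ t) := pos_of_mul_pos_right hw (hxpos t ⟨ht.1, htS⟩).le
    obtain ⟨-, ht2, ht3⟩ := H' t ht.1 ht.2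
    refine ⟨?_, ht2⟩
    by_contra! hneg
    exact absurd (sin_nonpos_of_nonpos_of_neg_pi_le hneg (by linarith)) (not_le.2 hsin)
  have key : ∀ s ∈ Ioo 0 S, 0 < ψ s ∧ ψ s < π / 2 := by
    intro s hs
    by_contra hbad
    have hεs : ε ≤ s := by
      by_contra! hlt
      exact hbad (hsmall s ⟨hs.1, hlt.le⟩)
    have hK : IsCompact (Icc ε s ∩ ψ ⁻¹' (Ioo 0 (π / 2))ᶜ) :=
      isCompact_Icc.of_isClosed_subset
        ((hψc.mono fun t ht => ⟨hε.le.trans ht.1, ht.2.trans_lt hs.2⟩).preimage_isClosed_of_isClosed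
          isClosed_Icc isOpen_Ioo.isClosed_compl) inter_subset_left
    obtain ⟨a, ⟨⟨haε, has⟩, ha⟩, hmin⟩ := hK.exists_isLeast ⟨s, ⟨hεs, le_rfl⟩, hbad⟩
    have ha0 : 0 < a := hε.trans_le haε
    have haS : a ∈ Ioo 0 S := ⟨ha0, has.trans_lt hs.2⟩
    have hgood : ∀ t ∈ Ioo 0 a, 0 < ψ t ∧ ψ t < π / 2 := by
      intro t ht
      by_contra hbt
      rcases le_total t ε with h | h
      · exact hbt (hsmall t ⟨ht.1, h⟩)
      · exact absurd (hmin ⟨⟨h, ht.2.le.trans has⟩, hbt⟩) (not_le.2 ht.2)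
    have hza : 0 < z a := by linarith [hz_lt a haS hgood]
    have hxa := hxpos a haS
    rcases le_or_gt (ψ a) 0 with h | h
    · obtain ⟨he, hd⟩ := (hψ' a haS).eq_and_nonpos_of_left_ge ha0
        (fun t ht => (hgood t ht).1.le) h
      simp only [he, cos_zero, sin_zero, mul_one, mul_zero, sub_zero, zero_div] at hd
      have : 0 < α * z a / (x a ^ 2 + z a ^ 2) := by positivity
      linarith
    · have h' : π / 2 ≤ ψ a := by
        by_contra! h'
        exact ha ⟨h, h'⟩
      obtain ⟨he, hd⟩ := (hψ' a haS).neg.eq_and_nonpos_of_left_ge ha0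
        (c := -(π / 2)) (fun t ht => neg_le_neg (hgood t ht).2.le) (neg_le_neg h')
      have he' : ψ a = π / 2 := neg_injective he
      simp only [he', cos_pi_div_two, sin_pi_div_two, mul_one, mul_zero, zero_sub, mul_neg,
        neg_div] at hd
      have h1 : 0 < α * x a / (x a ^ 2 + z a ^ 2) := by positivity
      have h2 : 0 < 1 / x a := by positivity
      linarith
  intro s hs
  obtain ⟨h1, h2⟩ := key s hs
  exact ⟨⟨h1, h2⟩, cos_pos_of_mem_Ioo ⟨by linarith, h2⟩,
    sin_pos_of_pos_of_lt_pi h1 (by linarith),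
    hz_lt s hs fun t ht => key t ⟨ht.1, ht.2.trans hs.2⟩⟩
end

section
/- Let −2 < α < 0. Let x, z, ψ : [0, ∞) → ℝ be continuous on [0, ∞), differentiable on (0, ∞), with x(0) = 0, z(0) = 1, ψ(0) = 0, x(s) > 0 for all s > 0, and satisfying for all s > 0: x'(s) = cos ψ(s), z'(s) = sin ψ(s), ψ'(s) = α·(z(s)cos ψ(s) − x(s)sin ψ(s))/(x(s)² + z(s)²) − sin ψ(s)/x(s). Then ψ(s) → 0 as s → ∞, x(s) → ∞ as s → ∞, and the curve oscillates along the x-axis: for every s₀ > 0 there exists s > s₀ with z(s) = 0. In particular there is S₀ > 0 such that cos ψ(s) > 0 for all s ≥ S₀, so the generating curve is a graph over the x-axis outside a compact set. -/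
open Real Set Filter

/-- The planar rotational system in polar form on `(0, ∞)`: `r`, `θ` are polar coordinates of the
generating curve, `β` is the angle between the tangent and the radial direction, and
`c = α + 2`. -/
structure IsPolarSolution (c : ℝ) (r θ β : ℝ → ℝ) : Prop where
  r_pos : ∀ s, 0 < s → 0 < r s
  cos_pos : ∀ s, 0 < s → 0 < cos (θ s)
  deriv_r : ∀ s, 0 < s → HasDerivAt r (cos (β s)) s
  deriv_θ : ∀ s, 0 < s → HasDerivAt θ (sin (β s) / r s) s
  deriv_β : ∀ s, 0 < s →
    HasDerivAt β (-(c * sin (β s) + cos (β s) * tan (θ s)) / r s) s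

theorem cos_arctan_div_mul_sqrt {x : ℝ} (hx : 0 < x) (z : ℝ) :
    √(x ^ 2 + z ^ 2) * cos (arctan (z / x)) = x := by
  have h : √(x ^ 2 + z ^ 2) = x * √(1 + (z / x) ^ 2) := by
    rw [show x ^ 2 + z ^ 2 = x ^ 2 * (1 + (z / x) ^ 2) by field_simp,
      sqrt_mul (by positivity), sqrt_sq hx.le]
  have h' : 0 < √(1 + (z / x) ^ 2) := by positivity
  rw [cos_arctan, h]
  field_simp

theorem sin_arctan_div_mul_sqrt {x : ℝ} (hx : 0 < x) (z : ℝ) :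
    √(x ^ 2 + z ^ 2) * sin (arctan (z / x)) = z := by
  have h := cos_arctan_div_mul_sqrt hx z
  have h' : sin (arctan (z / x)) = z / x * cos (arctan (z / x)) := by
    have := tan_mul_cos (cos_arctan_pos (z / x)).ne'
    rw [tan_arctan] at this
    exact this.symm
  rw [h', mul_left_comm, h]
  field_simp

theorem isPolarSolution_of_rotational {α : ℝ} {x z ψ : ℝ → ℝ}
    (hxpos : ∀ s : ℝ, 0 < s → 0 < x s)
    (hx' : ∀ s : ℝ, 0 < s → HasDerivAt x (cos (ψ s)) s)
    (hz' : ∀ s : ℝ, 0 < s → HasDerivAt z (sin (ψ s)) s)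
    (hψ' : ∀ s : ℝ, 0 < s → HasDerivAt ψ
      (α * (z s * cos (ψ s) - x s * sin (ψ s)) / (x s ^ 2 + z s ^ 2) - sin (ψ s) / x s) s) :
    IsPolarSolution (α + 2) (fun s => √(x s ^ 2 + z s ^ 2)) (fun s => arctan (z s / x s))
      (fun s => ψ s - arctan (z s / x s)) := by
  have hr : ∀ s, 0 < s → 0 < √(x s ^ 2 + z s ^ 2) := fun s hs => by
    have := hxpos s hs
    positivity
  have hθ : ∀ s, 0 < s → HasDerivAt (fun s => arctan (z s / x s))
      (sin (ψ s - arctan (z s / x s)) / √(x s ^ 2 + z s ^ 2)) s := fun s hs => by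
    have hx := hxpos s hs
    refine (((hz' s hs).div (hx' s hs) hx.ne').arctan).congr_deriv ?_
    have h1 := cos_arctan_div_mul_sqrt hx (z s)
    have h2 := sin_arctan_div_mul_sqrt hx (z s)
    have h3 := hr s hs
    have h4 : √(x s ^ 2 + z s ^ 2) ^ 2 = x s ^ 2 + z s ^ 2 := sq_sqrt (by positivity)
    rw [sin_sub]
    have h5 : 1 + (z s / x s) ^ 2 = √(x s ^ 2 + z s ^ 2) ^ 2 / x s ^ 2 := by
      rw [h4]; field_simp
    simp only [Pi.div_apply]
    rw [h5]
    generalize √(x s ^ 2 + z s ^ 2) = R at *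
    field_simp
    rw [← sub_eq_zero]
    linear_combination cos (ψ s) * h2 - sin (ψ s) * h1
  refine ⟨hr, fun s _ => cos_arctan_pos _, fun s hs => ?_, hθ, fun s hs => ?_⟩
  · have hx := hxpos s hs
    refine ((((hx' s hs).pow 2).add ((hz' s hs).pow 2)).sqrt (by
      simp only [Pi.add_apply, Pi.pow_apply]; positivity)).congr_deriv ?_
    have h1 := cos_arctan_div_mul_sqrt hx (z s)
    have h2 := sin_arctan_div_mul_sqrt hx (z s)
    have h3 := hr s hs
    simp only [Pi.add_apply, Pi.pow_apply]
    rw [cos_sub]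
    generalize √(x s ^ 2 + z s ^ 2) = R at *
    push_cast
    field_simp
    linear_combination -cos (ψ s) * h1 - sin (ψ s) * h2
  · refine ((hψ' s hs).sub (hθ s hs)).congr_deriv ?_
    have hx := hxpos s hs
    have h1 := cos_arctan_div_mul_sqrt hx (z s)
    have h2 := sin_arctan_div_mul_sqrt hx (z s)
    have h3 := hr s hs
    have h4 : x s ^ 2 + z s ^ 2 = √(x s ^ 2 + z s ^ 2) ^ 2 := (sq_sqrt (by positivity)).symm
    have hc := cos_arctan_pos (z s / x s)
    have h6 : sin (ψ s) = sin (ψ s - arctan (z s / x s)) * cos (arctan (z s / x s)) +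
        cos (ψ s - arctan (z s / x s)) * sin (arctan (z s / x s)) := by
      rw [← sin_add, sub_add_cancel]
    have h7 : z s * cos (ψ s) - x s * sin (ψ s) =
        -(√(x s ^ 2 + z s ^ 2) * sin (ψ s - arctan (z s / x s))) := by
      rw [sin_sub]
      linear_combination sin (ψ s) * h1 - cos (ψ s) * h2
    rw [h7, tan_eq_sin_div_cos]
    nth_rw 2 [h4]
    nth_rw 1 [h6]
    generalize √(x s ^ 2 + z s ^ 2) = R at *
    generalize arctan (z s / x s) = θ at *
    rw [← h1]
    field_simp
    ring

namespace IsPolarSolution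

variable {c : ℝ} {r θ β : ℝ → ℝ}

theorem hasDerivAt_cos_mul_cos (h : IsPolarSolution c r θ β) {s : ℝ} (hs : 0 < s) :
    HasDerivAt (fun s => cos (β s) * cos (θ s)) (c * sin (β s) ^ 2 * cos (θ s) / r s) s := by
  refine ((h.deriv_β s hs).cos.mul (h.deriv_θ s hs).cos).congr_deriv ?_
  have := h.cos_pos s hs
  have := h.r_pos s hs
  rw [tan_eq_sin_div_cos]
  field_simp
  ring

theorem monotoneOn_cos_mul_cos (h : IsPolarSolution c r θ β) (hc : 0 ≤ c) :
    MonotoneOn (fun s => cos (β s) * cos (θ s)) (Ioi 0) := by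
  refine monotoneOn_of_hasDerivWithinAt_nonneg (convex_Ioi 0)
    (fun s hs => (h.hasDerivAt_cos_mul_cos hs).continuousAt.continuousWithinAt)
    (f' := fun s => c * sin (β s) ^ 2 * cos (θ s) / r s)
    (fun s hs => ?_) (fun s hs => ?_)
  all_goals rw [interior_Ioi] at hs
  · exact (h.hasDerivAt_cos_mul_cos hs).hasDerivWithinAt
  · have := h.cos_pos s hs
    have := h.r_pos s hs
    positivity

theorem cos_mul_cos_pos (h : IsPolarSolution c r θ β) (hc : 0 < c)
    (h0 : Tendsto (fun s => cos (β s) * cos (θ s)) (nhdsWithin 0 (Ioi 0)) (nhds 0))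
    {s : ℝ} (hs : 0 < s) : 0 < cos (β s) * cos (θ s) := by
  have hm := h.monotoneOn_cos_mul_cos hc.le
  have hnonneg : ∀ t, 0 < t → 0 ≤ cos (β t) * cos (θ t) := fun t ht => by
    refine le_of_tendsto h0 ?_
    filter_upwards [Ioo_mem_nhdsGT ht] with u hu
    exact hm hu.1 ht hu.2.le
  refine (hnonneg s hs).lt_of_ne' fun hzero => ?_
  have hs2 : 0 < s / 2 := by positivity
  have hev : (fun t => cos (β t) * cos (θ t)) =ᶠ[nhds (s / 2)] fun _ => 0 := by
    filter_upwards [Ioo_mem_nhds hs2 (half_lt_self hs)] with t ht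
    refine le_antisymm ?_ (hnonneg t ht.1)
    rw [← hzero]
    exact hm ht.1 hs ht.2.le
  have hd := (h.hasDerivAt_cos_mul_cos hs2).unique
    ((hasDerivAt_const (s / 2) (0 : ℝ)).congr_of_eventuallyEq hev)
  have hcos := h.cos_pos _ hs2
  have hr := h.r_pos _ hs2
  have hb : sin (β (s / 2)) = 0 := by
    rcases div_eq_zero_iff.1 hd with hd | hd
    · simpa [hc.ne', hcos.ne'] using hd
    · exact absurd hd hr.ne'
  have hcb : cos (β (s / 2)) = 0 := by
    simpa [hcos.ne'] using hev.self_of_nhds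
  have := sin_sq_add_cos_sq (β (s / 2))
  simp [hb, hcb] at this

/-- Quantitative decay of the perturbed energy `1 - cos β cos θ + ε sin β sin θ`. -/
theorem tendsto_sq_sin_add_sq_sin (h : IsPolarSolution c r θ β) (hc : 0 < c)
    (hr : ∀ s, 0 < s → r s ≤ 1 + s) {s₁ : ℝ} (hs₁ : 0 < s₁)
    (hpos : 0 < cos (β s₁) * cos (θ s₁)) :
    Tendsto (fun s => sin (β s) ^ 2 + sin (θ s) ^ 2) atTop (nhds 0) := by
  set v := cos (β s₁) * cos (θ s₁)
  have hvle : ∀ s, s₁ ≤ s → v ≤ cos (β s) * cos (θ s) := fun s hs =>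
    h.monotoneOn_cos_mul_cos hc.le hs₁ (hs₁.trans_le hs) hs
  have hv1 : v ≤ 1 := by
    have := h.cos_pos s₁ hs₁
    nlinarith [cos_le_one (β s₁), cos_le_one (θ s₁)]
  set ε := c * v / (2 + c ^ 2) with hε
  have hε0 : 0 < ε := by positivity
  have hεc : ε * (2 + c ^ 2) = c * v := by rw [hε]; field_simp
  have hε2 : ε ≤ 1 / 2 := by
    rw [hε, div_le_iff₀ (by positivity)]
    nlinarith [sq_nonneg (c - 1)]
  set k := ε * v ^ 2 / 4 with hk
  have hk0 : 0 < k := by positivity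
  clear_value ε k v
  let L : ℝ → ℝ := fun s => 1 - cos (β s) * cos (θ s) + ε * (sin (β s) * sin (θ s))
  let L' : ℝ → ℝ := fun s => -(c * sin (β s) ^ 2 * cos (θ s) - ε * (sin (β s) ^ 2 * cos (θ s)
    - c * sin (β s) * cos (β s) * sin (θ s) - cos (β s) ^ 2 * sin (θ s) ^ 2 / cos (θ s))) / r s
  have hL : ∀ s, 0 < s → HasDerivAt L (L' s) s := fun s hs => by
    refine (((h.hasDerivAt_cos_mul_cos hs).const_sub 1).add
      (((h.deriv_β s hs).sin.mul (h.deriv_θ s hs).sin).const_mul ε)).congr_deriv ?_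
    have := h.cos_pos s hs
    have := h.r_pos s hs
    simp only [L']
    rw [tan_eq_sin_div_cos]
    field_simp
    ring
  have hLlow : ∀ s, (sin (β s) ^ 2 + sin (θ s) ^ 2) / 4 ≤ L s := fun s => by
    simp only [L]
    nlinarith [sin_sq_add_cos_sq (β s), sin_sq_add_cos_sq (θ s),
      sq_nonneg (cos (β s) - cos (θ s)), mul_nonneg hε0.le (sq_nonneg (sin (β s) + sin (θ s))),
      mul_nonneg (sub_nonneg.2 hε2) (add_nonneg (sq_nonneg (sin (β s))) (sq_nonneg (sin (θ s))))]
  have hLup : ∀ s, s₁ ≤ s → L s ≤ 2 * (sin (β s) ^ 2 + sin (θ s) ^ 2) := fun s hs => by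
    have hV := hpos.trans_le (hvle s hs)
    have hV1 : cos (β s) * cos (θ s) ≤ 1 := by
      nlinarith [cos_le_one (β s), cos_le_one (θ s), h.cos_pos s (hs₁.trans_le hs)]
    have h1 : 1 - cos (β s) * cos (θ s) ≤ sin (β s) ^ 2 + sin (θ s) ^ 2 := by
      have : (cos (β s) * cos (θ s)) ^ 2 = (1 - sin (β s) ^ 2) * (1 - sin (θ s) ^ 2) := by
        rw [mul_pow, cos_sq', cos_sq']
      nlinarith [mul_nonneg (sq_nonneg (sin (β s))) (sq_nonneg (sin (θ s)))]
    simp only [L]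
    nlinarith [mul_nonneg hε0.le (sq_nonneg (sin (β s) - sin (θ s))),
      mul_nonneg (sub_nonneg.2 hε2) (add_nonneg (sq_nonneg (sin (β s))) (sq_nonneg (sin (θ s))))]
  have hL' : ∀ s, s₁ ≤ s → L' s ≤ -k * L s / (1 + s) := fun s hs => by
    have hs0 := hs₁.trans_le hs
    have hC := h.cos_pos s hs0
    have hC1 := cos_le_one (θ s)
    have hV := hvle s hs
    have hB : 0 < cos (β s) := pos_of_mul_pos_left (hpos.trans_le hV) hC.le
    have hB1 := cos_le_one (β s)
    have hCv : v ≤ cos (θ s) := by nlinarith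
    have hBv : v ≤ cos (β s) := by nlinarith
    have hr0 := h.r_pos s hs0
    have hrs := hr s hs0
    have hL0 : 0 ≤ L s := le_trans (by positivity) (hLlow s)
    have hmain : k * L s ≤ c * sin (β s) ^ 2 * cos (θ s) - ε * (sin (β s) ^ 2 * cos (θ s)
        - c * sin (β s) * cos (β s) * sin (θ s) - cos (β s) ^ 2 * sin (θ s) ^ 2 / cos (θ s)) := by
      have h1 : cos (β s) ^ 2 * sin (θ s) ^ 2 ≤ cos (β s) ^ 2 * sin (θ s) ^ 2 / cos (θ s) :=
        le_div_self (by positivity) hC hC1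
      have h2 : v ^ 2 * sin (θ s) ^ 2 ≤ cos (β s) ^ 2 * sin (θ s) ^ 2 := by gcongr
      have h3 : c * sin (β s) ^ 2 * v ≤ c * sin (β s) ^ 2 * cos (θ s) := by gcongr
      have h4 : sin (β s) ^ 2 * cos (θ s) ≤ sin (β s) ^ 2 :=
        mul_le_of_le_one_right (sq_nonneg _) hC1
      have h5 : k * L s ≤ ε * v ^ 2 / 2 * (sin (β s) ^ 2 + sin (θ s) ^ 2) := by
        rw [hk]
        nlinarith [mul_le_mul_of_nonneg_left (hLup s hs) hk0.le]
      have h6 : v ^ 2 * sin (β s) ^ 2 ≤ sin (β s) ^ 2 :=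
        mul_le_of_le_one_left (sq_nonneg _) (by nlinarith)
      have h7 : sin (β s) ^ 2 * cos (θ s) - c * sin (β s) * cos (β s) * sin (θ s)
          - cos (β s) ^ 2 * sin (θ s) ^ 2 / cos (θ s) ≤
          (1 + c ^ 2 / 2) * sin (β s) ^ 2 - v ^ 2 * sin (θ s) ^ 2 / 2 := by
        nlinarith [sq_nonneg (c * sin (β s) + cos (β s) * sin (θ s))]
      have h8 := mul_le_mul_of_nonneg_left h7 hε0.le
      have h9 := mul_le_mul_of_nonneg_left h6 hε0.le
      have h10 : c * sin (β s) ^ 2 * v = ε * (2 + c ^ 2) * sin (β s) ^ 2 := by rw [hεc]; ring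
      have h11 : 0 ≤ ε * c ^ 2 * sin (β s) ^ 2 := by positivity
      have h12 : 0 ≤ ε * sin (β s) ^ 2 := by positivity
      linarith
    calc L' s ≤ -(k * L s) / r s := by
          simp only [L']
          gcongr
      _ ≤ -k * L s / (1 + s) := by
          rw [neg_mul, neg_div, neg_div, neg_le_neg_iff]
          gcongr
  have hanti : AntitoneOn (fun s => exp (k * log (1 + s)) * L s) (Ici s₁) := by
    have hd : ∀ s, 0 < s → HasDerivAt (fun s => exp (k * log (1 + s)) * L s)
        (exp (k * log (1 + s)) * (k * (1 / (1 + s))) * L s + exp (k * log (1 + s)) * L' s) s :=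
      fun s hs => by
        have h1 : HasDerivAt (fun s : ℝ => 1 + s) 1 s := (hasDerivAt_id s).const_add 1
        exact (((h1.log (by positivity)).const_mul k).exp).mul (hL s hs)
    refine antitoneOn_of_hasDerivWithinAt_nonpos (convex_Ici s₁)
      (fun s hs => (hd s (hs₁.trans_le hs)).continuousAt.continuousWithinAt)
      (f' := fun s => exp (k * log (1 + s)) * (k * (1 / (1 + s))) * L s +
        exp (k * log (1 + s)) * L' s) (fun s hs => ?_) (fun s hs => ?_)
    all_goals rw [interior_Ici] at hs
    · exact (hd s (hs₁.trans hs)).hasDerivWithinAt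
    · have := mul_le_mul_of_nonneg_left (hL' s (le_of_lt hs)) (exp_pos (k * log (1 + s))).le
      calc _ ≤ exp (k * log (1 + s)) * (k * (1 / (1 + s))) * L s +
            exp (k * log (1 + s)) * (-k * L s / (1 + s)) := by gcongr
        _ = 0 := by ring
        _ ≤ 0 := le_rfl
  set M := exp (k * log (1 + s₁)) * L s₁
  have hlog : Tendsto (fun s : ℝ => k * log (1 + s)) atTop atTop :=
    (tendsto_log_atTop.comp (tendsto_atTop_add_const_left _ 1 tendsto_id)).const_mul_atTop hk0
  have hlim : Tendsto (fun s : ℝ => 4 * (M * exp (-(k * log (1 + s))))) atTop (nhds 0) := by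
    simpa using ((tendsto_exp_neg_atTop_nhds_zero.comp hlog).const_mul M).const_mul 4
  refine squeeze_zero' (Eventually.of_forall fun s => by positivity) ?_ hlim
  filter_upwards [eventually_ge_atTop s₁] with s hs
  have h1 : exp (k * log (1 + s)) * L s ≤ M := hanti self_mem_Ici hs hs
  have h2 : L s ≤ M * exp (-(k * log (1 + s))) := by
    rw [exp_neg, ← div_eq_mul_inv, le_div_iff₀ (exp_pos _)]
    linarith
  linarith [hLlow s]

/-- Underdamped solutions converging to the equilibrium keep crossing `θ = 0`: otherwise
`tan β / sin θ` satisfies a Riccati inequality with no global solution. -/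
theorem exists_sin_eq_zero (h : IsPolarSolution c r θ β) (hc₀ : 0 < c) (hc₂ : c < 2)
    (hr : ∀ s, 0 < s → r s ≤ 1 + s)
    (hlim : Tendsto (fun s => cos (β s) * cos (θ s)) atTop (nhds 1)) (s₀ : ℝ) :
    ∃ s, s₀ < s ∧ sin (θ s) = 0 := by
  by_contra! hne
  set δ := (4 - c ^ 2) / 12 with hδ
  have hδ0 : 0 < δ := by rw [hδ]; nlinarith
  have hδ1 : δ < 1 / 2 := by rw [hδ]; nlinarith
  have hV2 : Tendsto (fun s => (cos (β s) * cos (θ s)) ^ 2) atTop (nhds 1) := by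
    simpa using hlim.pow 2
  obtain ⟨S, hS⟩ := eventually_atTop.1 (((hlim.eventually_const_lt zero_lt_one).and
    (hV2.eventually_const_lt (sub_lt_self 1 hδ0))).and
      ((eventually_gt_atTop 0).and (eventually_gt_atTop s₀)))
  let u : ℝ → ℝ := fun s => tan (β s) / sin (θ s)
  let u' : ℝ → ℝ := fun s => -(1 + c * cos (θ s) * u s + (cos (β s) * cos (θ s)) ^ 2 * u s ^ 2) /
    (cos (β s) * cos (θ s)) / r s
  have hu : ∀ s, S ≤ s → HasDerivAt u (u' s) s := fun s hs => by
    obtain ⟨⟨hV, -⟩, hs0, hss⟩ := hS s hs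
    have hC := h.cos_pos s hs0
    have hB : 0 < cos (β s) := pos_of_mul_pos_left hV hC.le
    have hr0 := h.r_pos s hs0
    have hsin := hne s hss
    have htan : HasDerivAt (fun s => tan (β s)) _ s :=
      (hasDerivAt_tan hB.ne').comp s (h.deriv_β s hs0)
    refine (htan.div (h.deriv_θ s hs0).sin hsin).congr_deriv ?_
    simp only [u', u, tan_eq_sin_div_cos]
    field_simp
    ring
  have hu' : ∀ s, S ≤ s → u' s ≤ -(δ * (1 + u s ^ 2)) / (1 + s) := fun s hs => by
    obtain ⟨⟨hV, hVδ⟩, hs0, -⟩ := hS s hs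
    have hC := h.cos_pos s hs0
    have hC1 := cos_le_one (θ s)
    have hB : 0 < cos (β s) := pos_of_mul_pos_left hV hC.le
    have hr0 := h.r_pos s hs0
    have hrs := hr s hs0
    have hV1 : cos (β s) * cos (θ s) ≤ 1 := by nlinarith [cos_le_one (β s)]
    have hquad : δ * (1 + u s ^ 2) ≤
        1 + c * cos (θ s) * u s + (cos (β s) * cos (θ s)) ^ 2 * u s ^ 2 := by
      have h1 : (1 - δ) * u s ^ 2 ≤ (cos (β s) * cos (θ s)) ^ 2 * u s ^ 2 := by gcongr
      have h2 : (c * cos (θ s)) ^ 2 ≤ c ^ 2 := by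
        rw [mul_pow]
        exact mul_le_of_le_one_right (sq_nonneg _) (by nlinarith)
      have h3 : 0 ≤ (1 - δ) + c * cos (θ s) * u s + (1 - 2 * δ) * u s ^ 2 := by
        have h4 : c ^ 2 = 4 - 12 * δ := by rw [hδ]; ring
        have h5 : 0 ≤ (2 * (1 - δ) + c * cos (θ s) * u s) ^ 2 +
          (c ^ 2 - (c * cos (θ s)) ^ 2) * u s ^ 2 + 8 * δ ^ 2 * u s ^ 2 :=
          add_nonneg (add_nonneg (sq_nonneg _)
            (mul_nonneg (sub_nonneg.2 h2) (sq_nonneg _))) (by positivity)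
        refine nonneg_of_mul_nonneg_right (a := 4 * (1 - δ)) ?_ (by linarith)
        rw [h4] at h5
        nlinarith [sq_nonneg (u s)]
      linarith
    have hq0 : 0 < δ * (1 + u s ^ 2) := by positivity
    have h1 : δ * (1 + u s ^ 2) ≤ (1 + c * cos (θ s) * u s +
        (cos (β s) * cos (θ s)) ^ 2 * u s ^ 2) / (cos (β s) * cos (θ s)) :=
      hquad.trans (le_div_self (hq0.le.trans hquad) hV hV1)
    simp only [u']
    rw [neg_div, neg_div, neg_div, neg_le_neg_iff]
    exact div_le_div₀ (hq0.le.trans h1) h1 hr0 hrs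
  have hanti : AntitoneOn (fun s => arctan (u s) + δ * log (1 + s)) (Ici S) := by
    have hd : ∀ s, S ≤ s → HasDerivAt (fun s => arctan (u s) + δ * log (1 + s))
        (1 / (1 + u s ^ 2) * u' s + δ * (1 / (1 + s))) s := fun s hs => by
      have hs0 : 0 < s := (hS s hs).2.1
      have h1 : HasDerivAt (fun s : ℝ => 1 + s) 1 s := (hasDerivAt_id s).const_add 1
      exact (hu s hs).arctan.add ((h1.log (by positivity)).const_mul δ)
    refine antitoneOn_of_hasDerivWithinAt_nonpos (convex_Ici S)
      (fun s hs => (hd s hs).continuousAt.continuousWithinAt)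
      (f' := fun s => 1 / (1 + u s ^ 2) * u' s + δ * (1 / (1 + s))) (fun s hs => ?_)
      (fun s hs => ?_)
    all_goals rw [interior_Ici] at hs
    · exact (hd s (le_of_lt hs)).hasDerivWithinAt
    · have hs0 : 0 < s := (hS s (le_of_lt hs)).2.1
      calc 1 / (1 + u s ^ 2) * u' s + δ * (1 / (1 + s))
          ≤ 1 / (1 + u s ^ 2) * (-(δ * (1 + u s ^ 2)) / (1 + s)) + δ * (1 / (1 + s)) := by
            gcongr
            exact hu' s (le_of_lt hs)
        _ = 0 := by
            have : (0 : ℝ) < 1 + u s ^ 2 := by positivity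
            field_simp
            ring
        _ ≤ 0 := le_rfl
  have hlog : Tendsto (fun s : ℝ => δ * log (1 + s)) atTop atTop :=
    (tendsto_log_atTop.comp (tendsto_atTop_add_const_left _ 1 tendsto_id)).const_mul_atTop hδ0
  obtain ⟨s, hs, hsS⟩ := ((hlog.eventually_gt_atTop
    (arctan (u S) + δ * log (1 + S) + π / 2)).and (eventually_ge_atTop S)).exists
  have h1 := hanti self_mem_Ici hsS hsS
  have h2 := neg_pi_div_two_lt_arctan (u s)
  simp only at h1
  linarith

end IsPolarSolution

theorem tendsto_zero_of_tendsto_sin_sq {f : ℝ → ℝ}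
    (hf : ∀ᶠ s in atTop, |f s| ≤ π / 2)
    (h : Tendsto (fun s => sin (f s) ^ 2) atTop (nhds 0)) : Tendsto f atTop (nhds 0) := by
  have h1 : Tendsto (fun s => sin (f s)) atTop (nhds 0) := by
    refine (tendsto_zero_iff_abs_tendsto_zero _).2 ?_
    simpa [Function.comp_def, sqrt_sq_eq_abs] using (continuous_sqrt.tendsto 0).comp h
  have h2 := (continuous_arcsin.tendsto 0).comp h1
  rw [arcsin_zero] at h2
  refine h2.congr' ?_
  filter_upwards [hf] with s hs
  exact arcsin_sin (abs_le.1 hs).1 (abs_le.1 hs).2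

/-- Thm. 5.2, case `−2 < α < 0`: for a global solution of the rotational
system (eq2) with initial conditions `x(0) = 0`, `z(0) = 1`, `ψ(0) = 0`, one has
`ψ(s) → 0`, `x(s) → ∞` as `s → ∞`, the curve crosses the `x`-axis beyond every `s₀ > 0`,
and `cos ψ(s) > 0` for all large `s` (the curve is eventually a graph over the `x`-axis). -/
theorem case_alpha_between (α : ℝ) (hα₁ : -2 < α) (hα₂ : α < 0)
    (x z ψ : ℝ → ℝ)
    (hxc : ContinuousOn x (Ici 0)) (hzc : ContinuousOn z (Ici 0))
    (hψc : ContinuousOn ψ (Ici 0))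
    (hx0 : x 0 = 0) (hz0 : z 0 = 1) (hψ0 : ψ 0 = 0)
    (hxpos : ∀ s : ℝ, 0 < s → 0 < x s)
    (hx' : ∀ s : ℝ, 0 < s → HasDerivAt x (cos (ψ s)) s)
    (hz' : ∀ s : ℝ, 0 < s → HasDerivAt z (sin (ψ s)) s)
    (hψ' : ∀ s : ℝ, 0 < s → HasDerivAt ψ
      (α * (z s * cos (ψ s) - x s * sin (ψ s)) / (x s ^ 2 + z s ^ 2) - sin (ψ s) / x s) s) :
    Tendsto ψ atTop (nhds 0) ∧
    Tendsto x atTop atTop ∧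
    (∀ s₀ : ℝ, 0 < s₀ → ∃ s, s₀ < s ∧ z s = 0) ∧
    (∃ S₀ : ℝ, 0 < S₀ ∧ ∀ s, S₀ ≤ s → 0 < cos (ψ s)) := by
  have h := isPolarSolution_of_rotational hxpos hx' hz' hψ'
  set r : ℝ → ℝ := fun s => √(x s ^ 2 + z s ^ 2) with hrdef
  set θ : ℝ → ℝ := fun s => arctan (z s / x s) with hθdef
  set β : ℝ → ℝ := fun s => ψ s - θ s with hβdef
  have hc : 0 < α + 2 := by linarith
  have hrx : ∀ s, 0 < s → r s * cos (θ s) = x s := fun s hs =>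
    cos_arctan_div_mul_sqrt (hxpos s hs) (z s)
  have hrz : ∀ s, 0 < s → r s * sin (θ s) = z s := fun s hs =>
    sin_arctan_div_mul_sqrt (hxpos s hs) (z s)
  have hrc : ContinuousOn r (Ici 0) := ((hxc.pow 2).add (hzc.pow 2)).sqrt
  have hr : ∀ s, 0 < s → r s ≤ 1 + s := fun s hs => by
    have hanti : AntitoneOn (fun s => r s - s) (Ici 0) := by
      refine antitoneOn_of_hasDerivWithinAt_nonpos (convex_Ici 0) (hrc.sub continuousOn_id)
        (f' := fun s => cos (β s) - 1) (fun s hs => ?_) (fun s _ => by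
          linarith [cos_le_one (β s)])
      rw [interior_Ici] at hs
      exact ((h.deriv_r s hs).sub (hasDerivAt_id s)).hasDerivWithinAt
    have h1 := hanti self_mem_Ici hs.le hs.le
    have h2 : r 0 = 1 := by simp [hrdef, hx0, hz0]
    simp only [h2] at h1
    linarith
  have hV0 : Tendsto (fun s => cos (β s) * cos (θ s)) (nhdsWithin 0 (Ioi 0)) (nhds 0) := by
    have hcont : ContinuousWithinAt
        (fun s => x s * (x s * cos (ψ s) + z s * sin (ψ s)) / r s ^ 2) (Ioi 0) 0 := by
      have hmem : (0 : ℝ) ∈ Ici (0 : ℝ) := self_mem_Ici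
      have hx := hxc 0 hmem
      have hz := hzc 0 hmem
      have hψ := hψc 0 hmem
      refine ContinuousWithinAt.mono ?_ Ioi_subset_Ici_self
      refine (hx.mul ((hx.mul (continuous_cos.continuousAt.comp_continuousWithinAt hψ)).add
        (hz.mul (continuous_sin.continuousAt.comp_continuousWithinAt hψ)))).div
          ((hrc 0 hmem).pow 2) ?_
      simp [hrdef, hx0, hz0]
    have hlim := hcont.tendsto
    simp only [hx0, zero_mul, zero_div] at hlim
    refine hlim.congr' ?_
    filter_upwards [self_mem_nhdsWithin] with s hs
    have hr0 := h.r_pos s hs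
    rw [← hrx s hs, ← hrz s hs]
    simp only [hβdef]
    rw [cos_sub]
    field_simp
  have hVpos : ∀ s, 0 < s → 0 < cos (β s) * cos (θ s) := fun s hs => h.cos_mul_cos_pos hc hV0 hs
  have hcosβ : ∀ s, 0 < s → 0 < cos (β s) := fun s hs =>
    pos_of_mul_pos_left (hVpos s hs) (h.cos_pos s hs).le
  have hθbd : ∀ s, |θ s| < π / 2 := fun s => abs_lt.2 (arctan_mem_Ioo _)
  have hβc : ContinuousOn β (Ioi 0) := fun s hs =>
    (h.deriv_β s hs).continuousAt.continuousWithinAt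
  have hβbd : ∀ s, 0 < s → |β s| < π / 2 := fun s hs => by
    have hev : ∀ᶠ t in nhdsWithin 0 (Ioi 0), |ψ t| < π / 2 := by
      have hψ := ((hψc 0 self_mem_Ici).mono Ioi_subset_Ici_self).abs.tendsto
      rw [hψ0, abs_zero] at hψ
      exact hψ.eventually_lt_const (by positivity)
    obtain ⟨t, ht, ht0⟩ := (hev.and self_mem_nhdsWithin).exists
    have htπ : |β t| < π := by
      have := abs_sub (ψ t) (θ t)
      have := hθbd t
      simp only [hβdef]
      linarith
    have htβ : |β t| < π / 2 := by
      by_contra! hge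
      have := cos_nonpos_of_pi_div_two_le_of_le hge (by linarith [pi_pos])
      rw [cos_abs] at this
      exact absurd this (hcosβ t ht0).not_ge
    by_contra! hge
    obtain ⟨w, hw, hw2⟩ := (isPreconnected_Ioi (a := (0 : ℝ))).intermediate_value ht0 hs hβc.abs
      ⟨htβ.le, hge⟩
    have := hcosβ w hw
    rw [← cos_abs, show |β w| = π / 2 from hw2, cos_pi_div_two] at this
    exact lt_irrefl _ this
  have hsum := h.tendsto_sq_sin_add_sq_sin hc hr zero_lt_one (hVpos 1 zero_lt_one)
  have hβ0 : Tendsto β atTop (nhds 0) := by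
    refine tendsto_zero_of_tendsto_sin_sq ?_ (squeeze_zero (fun s => sq_nonneg _)
      (fun s => le_add_of_nonneg_right (sq_nonneg (sin (θ s)))) hsum)
    filter_upwards [eventually_gt_atTop 0] with s hs using (hβbd s hs).le
  have hθ0 : Tendsto θ atTop (nhds 0) :=
    tendsto_zero_of_tendsto_sin_sq (Eventually.of_forall fun s => (hθbd s).le)
      (squeeze_zero (fun s => sq_nonneg _)
        (fun s => le_add_of_nonneg_left (sq_nonneg (sin (β s)))) hsum)
  have hψlim : Tendsto ψ atTop (nhds 0) := by
    simpa [hβdef] using hβ0.add hθ0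
  have hcosψ : Tendsto (fun s => cos (ψ s)) atTop (nhds 1) := by
    simpa [Function.comp_def] using (continuous_cos.tendsto 0).comp hψlim
  obtain ⟨S, hS⟩ := eventually_atTop.1 ((hcosψ.eventually_const_lt
    (show (1 / 2 : ℝ) < 1 by norm_num)).and (eventually_gt_atTop 0))
  have hS0 : 0 < S := (hS S le_rfl).2
  refine ⟨hψlim, ?_, fun s₀ hs₀ => ?_, S, hS0, fun s hs => by linarith [(hS s hs).1]⟩
  · have hmono : MonotoneOn (fun s => x s - 1 / 2 * s) (Ici S) := by
      refine monotoneOn_of_hasDerivWithinAt_nonneg (convex_Ici S)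
        ((hxc.mono (Ici_subset_Ici.2 hS0.le)).sub (by fun_prop))
        (f' := fun s => cos (ψ s) - 1 / 2 * 1) (fun s hs => ?_) (fun s hs => ?_)
      all_goals rw [interior_Ici] at hs
      · exact ((hx' s (hS0.trans hs)).sub
          ((hasDerivAt_id s).const_mul (1 / 2))).hasDerivWithinAt
      · linarith [(hS s (le_of_lt hs)).1]
    refine tendsto_atTop_mono' _ ?_ (tendsto_atTop_add_const_left _ (x S - 1 / 2 * S)
      (tendsto_id.const_mul_atTop (show (0 : ℝ) < 1 / 2 by norm_num)))
    filter_upwards [eventually_ge_atTop S] with s hs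
    have := hmono self_mem_Ici hs hs
    simp only [id] at this ⊢
    linarith
  · have hV1 : Tendsto (fun s => cos (β s) * cos (θ s)) atTop (nhds 1) := by
      simpa [Function.comp_def] using ((continuous_cos.tendsto 0).comp hβ0).mul
        ((continuous_cos.tendsto 0).comp hθ0)
    obtain ⟨s, hs, hsin⟩ := h.exists_sin_eq_zero hc (by linarith) hr hV1 s₀
    exact ⟨s, hs, by rw [← hrz s (hs₀.trans hs), hsin, mul_zero]⟩
end

section
/- Let α = −2 and S > 0. Let x, z, ψ : [0, S) → ℝ be continuous on [0, S), differentiable on (0, S), with x(0) = 0, z(0) = 1, ψ(0) = 0, x(s) > 0 for all s ∈ (0, S), and satisfying for all s ∈ (0, S): x'(s) = cos ψ(s), z'(s) = sin ψ(s), ψ'(s) = −2·(z(s)cos ψ(s) − x(s)sin ψ(s))/(x(s)² + z(s)²) − sin ψ(s)/x(s). Then for all s ∈ [0, S): x(s) = sin s, z(s) = cos s and ψ(s) = −s; that is, the generating curve is the unit circle centered at the origin, and the corresponding surface is the unit sphere centered at 0. -/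
open Real Set

/-- A function continuous on `[0, S)` with vanishing derivative on `(0, S)` is constant. -/
lemma eq_initial_value_of_hasDerivAt_zero {S : ℝ} {f : ℝ → ℝ} (hf : ContinuousOn f (Ico 0 S))
    (hf' : ∀ s ∈ Ioo 0 S, HasDerivAt f 0 s) : ∀ s ∈ Ico 0 S, f s = f 0 := by
  intro s hs
  rcases hs.1.eq_or_lt with rfl | h0
  · rfl
  · obtain ⟨c, -, hc⟩ := exists_hasDerivAt_eq_slope f (fun _ => 0) h0
      (hf.mono fun t ht => ⟨ht.1, ht.2.trans_lt hs.2⟩)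
      (fun t ht => hf' t ⟨ht.1, ht.2.trans hs.2⟩)
    rw [eq_div_iff (by linarith)] at hc
    linarith

/-- Thm. 5.3, case `α = −2`: the solution of the rotational system (eq2) with
initial conditions `x(0) = 0`, `z(0) = 1`, `ψ(0) = 0` is the unit circle centered at the
origin: `x(s) = sin s`, `z(s) = cos s`, `ψ(s) = −s`. -/
theorem case_alpha_minus_two (S : ℝ) (hS : 0 < S)
    (x z ψ : ℝ → ℝ)
    (hxc : ContinuousOn x (Ico 0 S)) (hzc : ContinuousOn z (Ico 0 S))
    (hψc : ContinuousOn ψ (Ico 0 S))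
    (hx0 : x 0 = 0) (hz0 : z 0 = 1) (hψ0 : ψ 0 = 0)
    (hxpos : ∀ s ∈ Ioo 0 S, 0 < x s)
    (hx' : ∀ s ∈ Ioo 0 S, HasDerivAt x (cos (ψ s)) s)
    (hz' : ∀ s ∈ Ioo 0 S, HasDerivAt z (sin (ψ s)) s)
    (hψ' : ∀ s ∈ Ioo 0 S, HasDerivAt ψ
      ((-2 : ℝ) * (z s * cos (ψ s) - x s * sin (ψ s)) / (x s ^ 2 + z s ^ 2)
        - sin (ψ s) / x s) s) :
    ∀ s ∈ Ico 0 S, x s = sin s ∧ z s = cos s ∧ ψ s = -s := by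
  have hcos : ContinuousOn (fun s => cos (ψ s)) (Ico 0 S) := continuous_cos.comp_continuousOn hψc
  have hsin : ContinuousOn (fun s => sin (ψ s)) (Ico 0 S) := continuous_sin.comp_continuousOn hψc
  have hr : ∀ s ∈ Ico 0 S, x s ^ 2 + z s ^ 2 ≠ 0 := by
    intro s hs
    rcases hs.1.eq_or_lt with rfl | h0
    · simp [hx0, hz0]
    · have := hxpos s ⟨h0, hs.2⟩
      positivity
  -- The flux of the dilation field is conserved, hence zero.
  have hJ := eq_initial_value_of_hasDerivAt_zero
    (f := fun s => x s * (x s * cos (ψ s) + z s * sin (ψ s)) / (x s ^ 2 + z s ^ 2))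
    ((hxc.mul ((hxc.mul hcos).add (hzc.mul hsin))).div ((hxc.pow 2).add (hzc.pow 2)) hr) (by
      intro s hs
      have hx := hx' s hs
      have hz := hz' s hs
      have hψ := hψ' s hs
      have hxs := (hxpos s hs).ne'
      have hrs := hr s ⟨hs.1.le, hs.2⟩
      have h := (hx.mul ((hx.mul hψ.cos).add (hz.mul hψ.sin))).div
        ((hx.pow 2).add (hz.pow 2)) hrs
      refine h.congr_deriv ?_
      simp only [Pi.add_apply, Pi.mul_apply, Pi.pow_apply]
      field_simp
      push_cast
      ring)
  have hu : ∀ s ∈ Ioo 0 S, x s * cos (ψ s) + z s * sin (ψ s) = 0 := by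
    intro s hs
    have h := hJ s ⟨hs.1.le, hs.2⟩
    simpa [hx0, (hxpos s hs).ne', hr s ⟨hs.1.le, hs.2⟩] using h
  -- The support function is therefore constant.
  have hv := eq_initial_value_of_hasDerivAt_zero
    (f := fun s => z s * cos (ψ s) - x s * sin (ψ s))
    ((hzc.mul hcos).sub (hxc.mul hsin)) (by
      intro s hs
      refine (((hz' s hs).mul (hψ' s hs).cos).sub ((hx' s hs).mul (hψ' s hs).sin)).congr_deriv ?_
      linear_combination (-((-2 : ℝ) * (z s * cos (ψ s) - x s * sin (ψ s)) / (x s ^ 2 + z s ^ 2)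
        - sin (ψ s) / x s)) * hu s hs)
  simp only [hx0, hz0, hψ0, cos_zero, sin_zero, mul_zero, sub_zero, mul_one] at hv
  have hxψ : ∀ s ∈ Ioo 0 S, x s = -sin (ψ s) := by
    intro s hs
    linear_combination cos (ψ s) * hu s hs - sin (ψ s) * hv s ⟨hs.1.le, hs.2⟩
      - x s * sin_sq_add_cos_sq (ψ s)
  have hzψ : ∀ s ∈ Ioo 0 S, z s = cos (ψ s) := by
    intro s hs
    linear_combination sin (ψ s) * hu s hs + cos (ψ s) * hv s ⟨hs.1.le, hs.2⟩
      - z s * sin_sq_add_cos_sq (ψ s)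
  have hψs := eq_initial_value_of_hasDerivAt_zero (f := fun s => ψ s + s)
    (hψc.add continuousOn_id) (by
      intro s hs
      refine ((hψ' s hs).add (hasDerivAt_id s)).congr_deriv ?_
      have h1 : x s ^ 2 + z s ^ 2 = 1 := by
        rw [hxψ s hs, hzψ s hs, neg_sq, sin_sq_add_cos_sq]
      have h2 : sin (ψ s) / x s = -1 := by
        rw [div_eq_iff (hxpos s hs).ne', hxψ s hs]
        ring
      rw [h1, h2, hv s ⟨hs.1.le, hs.2⟩]
      norm_num)
  intro s hs
  rcases hs.1.eq_or_lt with rfl | h0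
  · simp [hx0, hz0, hψ0]
  · have hψ : ψ s = -s := by
      have := hψs s hs
      simp only [hψ0] at this
      linarith
    rw [hxψ s ⟨h0, hs.2⟩, hzψ s ⟨h0, hs.2⟩, hψ]
    simp
end

section
/- Let α = −4 and S > 0. Let x, z, ψ : [0, S) → ℝ be continuous on [0, S), differentiable on (0, S), with x(0) = 0, z(0) = 1, ψ(0) = 0, x(s) > 0 for all s ∈ (0, S), and satisfying for all s ∈ (0, S): x'(s) = cos ψ(s), z'(s) = sin ψ(s), ψ'(s) = −4·(z(s)cos ψ(s) − x(s)sin ψ(s))/(x(s)² + z(s)²) − sin ψ(s)/x(s). Then for all s ∈ [0, S): x(s) = sin(2s)/2, z(s) = (1 + cos(2s))/2 and ψ(s) = −2s; in particular x(s)² + (z(s) − 1/2)² = 1/4, so the generating curve is the circle of radius 1/2 centered at (0, 1/2), and the corresponding surface is a sphere through the origin. -/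
open Real Set

/-- A function continuous on `[0, S)` with nonnegative derivative on `(0, S)` is bounded below by
its value at `0`. -/
theorem apply_zero_le_of_hasDerivAt_nonneg {S : ℝ} {f f' : ℝ → ℝ}
    (hc : ContinuousOn f (Ico 0 S)) (hd : ∀ s ∈ Ioo 0 S, HasDerivAt f (f' s) s)
    (hf' : ∀ s ∈ Ioo 0 S, 0 ≤ f' s) : ∀ s ∈ Ico 0 S, f 0 ≤ f s := by
  intro s hs
  have hmono : MonotoneOn f (Ico 0 S) := by
    apply monotoneOn_of_deriv_nonneg (convex_Ico 0 S) hc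
    · rw [interior_Ico]
      exact fun t ht => (hd t ht).differentiableAt.differentiableWithinAt
    · rw [interior_Ico]
      intro t ht
      rw [(hd t ht).deriv]
      exact hf' t ht
  exact hmono ⟨le_rfl, hs.1.trans_lt hs.2⟩ hs hs.1

/-- A function continuous on `[0, S)` with zero derivative on `(0, S)` is constant. -/
theorem eq_apply_zero_of_hasDerivAt_zero {S : ℝ} {f : ℝ → ℝ}
    (hc : ContinuousOn f (Ico 0 S)) (hd : ∀ s ∈ Ioo 0 S, HasDerivAt f 0 s) :
    ∀ s ∈ Ico 0 S, f s = f 0 := by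
  intro s hs
  have h₁ := apply_zero_le_of_hasDerivAt_nonneg hc hd (fun _ _ => le_rfl) s hs
  have h₂ := apply_zero_le_of_hasDerivAt_nonneg (f := fun t => -f t) (f' := fun _ => 0) hc.neg
    (fun t ht => (hd t ht).neg.congr_deriv neg_zero) (fun _ _ => le_rfl) s hs
  exact le_antisymm (neg_le_neg_iff.mp h₂) h₁

/-- Thm. 5.3, case `α = −4`: the solution of the rotational system (eq2) with
initial conditions `x(0) = 0`, `z(0) = 1`, `ψ(0) = 0` is the circle of radius `1/2` centered
at `(0, 1/2)`: `x(s) = sin(2s)/2`, `z(s) = (1 + cos(2s))/2`, `ψ(s) = −2s`; in particular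
`x² + (z − 1/2)² = 1/4`, so the surface is a sphere through the origin. -/
theorem case_alpha_minus_four (S : ℝ) (hS : 0 < S)
    (x z ψ : ℝ → ℝ)
    (hxc : ContinuousOn x (Ico 0 S)) (hzc : ContinuousOn z (Ico 0 S))
    (hψc : ContinuousOn ψ (Ico 0 S))
    (hx0 : x 0 = 0) (hz0 : z 0 = 1) (hψ0 : ψ 0 = 0)
    (hxpos : ∀ s ∈ Ioo 0 S, 0 < x s)
    (hx' : ∀ s ∈ Ioo 0 S, HasDerivAt x (cos (ψ s)) s)
    (hz' : ∀ s ∈ Ioo 0 S, HasDerivAt z (sin (ψ s)) s)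
    (hψ' : ∀ s ∈ Ioo 0 S, HasDerivAt ψ
      ((-4 : ℝ) * (z s * cos (ψ s) - x s * sin (ψ s)) / (x s ^ 2 + z s ^ 2)
        - sin (ψ s) / x s) s) :
    ∀ s ∈ Ico 0 S, (x s = sin (2 * s) / 2 ∧ z s = (1 + cos (2 * s)) / 2 ∧ ψ s = -2 * s) ∧
      x s ^ 2 + (z s - 1 / 2) ^ 2 = 1 / 4 := by
  have hr : ∀ s ∈ Ico 0 S, 0 < x s ^ 2 + z s ^ 2 := by
    intro s hs
    rcases hs.1.eq_or_lt with h | h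
    · rw [← h, hx0, hz0]; norm_num
    · have := hxpos s ⟨h, hs.2⟩
      positivity
  have hIoo : ∀ s ∈ Ioo 0 S, s ∈ Ico 0 S := fun s hs => Ioo_subset_Ico_self hs
  -- With `θ` the angle from the tangent of the circle through the origin to the curve,
  -- `cos θ` is nondecreasing and starts at its maximal value `1`.
  have hcos : ∀ s ∈ Ico 0 S,
      1 ≤ (cos (ψ s) * (z s ^ 2 - x s ^ 2) - 2 * x s * z s * sin (ψ s)) /
        (x s ^ 2 + z s ^ 2) := by
    intro s hs
    have key := apply_zero_le_of_hasDerivAt_nonneg (S := S)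
      (f := fun s => (cos (ψ s) * (z s ^ 2 - x s ^ 2) - 2 * x s * z s * sin (ψ s)) /
        (x s ^ 2 + z s ^ 2))
      (f' := fun s => ((sin (ψ s) * (z s ^ 2 - x s ^ 2) + 2 * x s * z s * cos (ψ s)) /
        (x s ^ 2 + z s ^ 2)) ^ 2 / x s)
      (ContinuousOn.div (by fun_prop) (by fun_prop) (fun t ht => (hr t ht).ne'))
      ?_ (fun t ht => div_nonneg (sq_nonneg _) (hxpos t ht).le) s hs
    · simpa [hx0, hz0, hψ0] using key
    · intro t ht
      have hD := (hr t (hIoo t ht)).ne'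
      have hX := (hxpos t ht).ne'
      have dx := hx' t ht
      have dz := hz' t ht
      have dψ := hψ' t ht
      refine HasDerivAt.congr_deriv (((dψ.cos.mul ((dz.pow 2).sub (dx.pow 2))).sub
        (((dx.const_mul 2).mul dz).mul dψ.sin)).div ((dx.pow 2).add (dz.pow 2)) hD) ?_
      simp only [Pi.sub_apply, Pi.mul_apply, Pi.pow_apply]
      field_simp
      ring
  have htan : ∀ s ∈ Ico 0 S,
      cos (ψ s) * (x s ^ 2 + z s ^ 2) = z s ^ 2 - x s ^ 2 ∧
        sin (ψ s) * (x s ^ 2 + z s ^ 2) = -(2 * x s * z s) := by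
    intro s hs
    have h := hcos s hs
    rw [one_le_div (hr s hs)] at h
    have h1 := sin_sq_add_cos_sq (ψ s)
    have hD := hr s hs
    have hsum : (cos (ψ s) * (x s ^ 2 + z s ^ 2) - (z s ^ 2 - x s ^ 2)) ^ 2 +
        (sin (ψ s) * (x s ^ 2 + z s ^ 2) + 2 * x s * z s) ^ 2 ≤ 0 := by
      have := mul_le_mul_of_nonneg_left h hD.le
      linear_combination 2 * this + (x s ^ 2 + z s ^ 2) ^ 2 * h1
    constructor <;> nlinarith [sq_nonneg (cos (ψ s) * (x s ^ 2 + z s ^ 2) - (z s ^ 2 - x s ^ 2)),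
      sq_nonneg (sin (ψ s) * (x s ^ 2 + z s ^ 2) + 2 * x s * z s)]
  have hcirc : ∀ s ∈ Ico 0 S, z s = x s ^ 2 + z s ^ 2 := by
    intro s hs
    have key := eq_apply_zero_of_hasDerivAt_zero (S := S)
      (f := fun s => z s / (x s ^ 2 + z s ^ 2))
      (ContinuousOn.div (by fun_prop) (by fun_prop) (fun t ht => (hr t ht).ne')) ?_ s hs
    · simp only [hx0, hz0] at key
      rw [div_eq_iff (hr s hs).ne'] at key
      linarith
    · intro t ht
      have hD := (hr t (hIoo t ht)).ne'
      obtain ⟨hc, hn⟩ := htan t (hIoo t ht)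
      refine HasDerivAt.congr_deriv ((hz' t ht).div (((hx' t ht).pow 2).add ((hz' t ht).pow 2)) hD) ?_
      rw [← eq_div_iff hD] at hc hn
      rw [hc, hn]
      field_simp
      ring
  have hangle : ∀ s ∈ Ico 0 S, ψ s = -2 * s := by
    intro s hs
    have key := eq_apply_zero_of_hasDerivAt_zero (S := S) (f := fun s => ψ s + 2 * s)
      (by fun_prop) ?_ s hs
    · simp only [hψ0] at key
      linarith
    · intro t ht
      have hD := hr t (hIoo t ht)
      have hX := (hxpos t ht).ne'
      have hC := hcirc t (hIoo t ht)
      obtain ⟨hc, hn⟩ := htan t (hIoo t ht)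
      have hZ : z t ≠ 0 := by rw [hC]; exact hD.ne'
      refine HasDerivAt.congr_deriv ((hψ' t ht).add ((hasDerivAt_id t).const_mul 2)) ?_
      rw [← eq_div_iff hD.ne'] at hc hn
      rw [hc, hn, ← hC]
      field_simp
      linear_combination 4 * hC
  intro s hs
  have hC := hcirc s hs
  have hψs := hangle s hs
  obtain ⟨hc, hn⟩ := htan s hs
  have hZ : z s ≠ 0 := by rw [hC]; exact (hr s hs).ne'
  rw [← hC, hψs, neg_mul, cos_neg] at hc
  rw [← hC, hψs, neg_mul, sin_neg] at hn
  refine ⟨⟨?_, ?_, hψs⟩, by linear_combination -hC⟩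
  · apply mul_right_cancel₀ hZ
    linear_combination (1 / 2) * hn
  · apply mul_right_cancel₀ hZ
    linear_combination (-1 / 2) * hc - (1 / 2) * hC
end

section
/- Let −4 < α < −2 and S ∈ (0, ∞). Let x, z, ψ : [0, S) → ℝ be continuous on [0, S), differentiable on (0, S), with x(0) = 0, z(0) = 1, ψ(0) = 0, x(s) > 0 for all s ∈ (0, S), satisfying the system (eq2) on (0, S), and suppose x(s) → 0 and z(s) → 0 as s → S⁻ (the curve reaches the origin). Then the generating curve crosses the x-axis infinitely many times near the origin: for every s₀ ∈ (0, S) there exists s ∈ (s₀, S) with z(s) = 0. In particular the curve has points in both open half-planes z > 0 and z < 0. -/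
open Real Set Filter

/-- Along a solution with profile angle `ψ`, the quantity
`w = x (z cos ψ - x sin ψ) / (z r)`, with `r` the distance to the origin, satisfies the Riccati
equation `r w' = 1 - (α + 2) w r' + w²`. -/
lemma hasDerivAt_riccati {α s : ℝ} {x z ψ : ℝ → ℝ} (hx : 0 < x s) (hz : z s ≠ 0)
    (hx' : HasDerivAt x (cos (ψ s)) s) (hz' : HasDerivAt z (sin (ψ s)) s)
    (hψ' : HasDerivAt ψ
      (α * (z s * cos (ψ s) - x s * sin (ψ s)) / (x s ^ 2 + z s ^ 2) - sin (ψ s) / x s) s) :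
    HasDerivAt (fun t => (z t * cos (ψ t) - x t * sin (ψ t)) * x t / (z t * √(x t ^ 2 + z t ^ 2)))
      ((1 - (α + 2) * ((z s * cos (ψ s) - x s * sin (ψ s)) * x s / (z s * √(x s ^ 2 + z s ^ 2))) *
          ((x s * cos (ψ s) + z s * sin (ψ s)) / √(x s ^ 2 + z s ^ 2)) +
        ((z s * cos (ψ s) - x s * sin (ψ s)) * x s / (z s * √(x s ^ 2 + z s ^ 2))) ^ 2) /
        √(x s ^ 2 + z s ^ 2)) s := by
  have hN : 0 < x s ^ 2 + z s ^ 2 := by positivity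
  have hr : 0 < √(x s ^ 2 + z s ^ 2) := sqrt_pos.2 hN
  have hsq : √(x s ^ 2 + z s ^ 2) ^ 2 = x s ^ 2 + z s ^ 2 := sq_sqrt hN.le
  have hr' := ((hx'.fun_pow 2).fun_add (hz'.fun_pow 2)).sqrt hN.ne'
  have hD := (hz'.fun_mul hψ'.cos).fun_sub (hx'.fun_mul hψ'.sin)
  refine ((hD.fun_mul hx').fun_div (hz'.fun_mul hr') (mul_ne_zero hz hr.ne')).congr_deriv ?_
  have hcs := sin_sq_add_cos_sq (ψ s)
  generalize √(x s ^ 2 + z s ^ 2) = r at *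
  rw [← hsq]
  generalize sin (ψ s) = σ at *
  generalize cos (ψ s) = c at *
  generalize x s = X at *
  generalize z s = Z at *
  field_simp
  norm_num
  linear_combination 2 * (r ^ 2 * Z ^ 2 * hcs - X * (Z * c - X * σ) * σ * hsq)

/-- If a function has lower derivative bound `-K` times itself and is nonnegative, then vanishing
at the right endpoint forces vanishing at the left endpoint. -/
lemma eq_zero_left_of_neg_mul_le_deriv {E E' : ℝ → ℝ} {a b K : ℝ} (hab : a ≤ b)
    (hE : ∀ s ∈ Icc a b, HasDerivAt E (E' s) s) (hle : ∀ s ∈ Icc a b, -K * E s ≤ E' s)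
    (hnn : 0 ≤ E a) (hb : E b = 0) : E a = 0 := by
  have hd : ∀ s ∈ Icc a b, HasDerivAt (fun t => E t * exp (K * t))
      (E' s * exp (K * s) + E s * (exp (K * s) * K)) s := fun s hs => by
    simpa using (hE s hs).fun_mul ((hasDerivAt_id s).const_mul K).exp
  have hmono : MonotoneOn (fun t => E t * exp (K * t)) (Icc a b) := by
    refine monotoneOn_of_deriv_nonneg (convex_Icc a b)
      (fun s hs => (hd s hs).continuousAt.continuousWithinAt)
      (fun s hs => (hd s (interior_subset hs)).differentiableAt.differentiableWithinAt) ?_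
    intro s hs
    rw [(hd s (interior_subset hs)).deriv]
    have := hle s (interior_subset hs)
    have := exp_pos (K * s)
    nlinarith
  have h := hmono (left_mem_Icc.2 hab) (right_mem_Icc.2 hab) hab
  simp only [hb, zero_mul] at h
  exact le_antisymm (nonpos_of_mul_nonpos_left h (exp_pos _)) hnn

/-- A solution tending to the origin, with `α ∈ (-4, 0)`, has zeros of `z` arbitrarily
close to the final parameter. -/
lemma exists_zero_of_tendsto_origin {α S s₀ : ℝ} {x z ψ : ℝ → ℝ} (hα₁ : -4 < α) (hα₂ : α < 0)
    (hs₀ : s₀ < S)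
    (hxpos : ∀ s ∈ Ioo s₀ S, 0 < x s)
    (hx' : ∀ s ∈ Ioo s₀ S, HasDerivAt x (cos (ψ s)) s)
    (hz' : ∀ s ∈ Ioo s₀ S, HasDerivAt z (sin (ψ s)) s)
    (hψ' : ∀ s ∈ Ioo s₀ S, HasDerivAt ψ
      (α * (z s * cos (ψ s) - x s * sin (ψ s)) / (x s ^ 2 + z s ^ 2) - sin (ψ s) / x s) s)
    (hxlim : Tendsto x (nhdsWithin S (Iio S)) (nhds 0))
    (hzlim : Tendsto z (nhdsWithin S (Iio S)) (nhds 0)) :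
    ∃ s ∈ Ioo s₀ S, z s = 0 := by
  by_contra! hz
  obtain ⟨c, hc, hc₁, hc₂⟩ : ∃ c > 0, c ≤ 1 - (α + 2) / 2 ∧ c ≤ 1 + (α + 2) / 2 :=
    ⟨min (1 - (α + 2) / 2) (1 + (α + 2) / 2), lt_min (by linarith) (by linarith),
      min_le_left _ _, min_le_right _ _⟩
  set r : ℝ → ℝ := fun t => √(x t ^ 2 + z t ^ 2) with hrdef
  set w : ℝ → ℝ := fun t => (z t * cos (ψ t) - x t * sin (ψ t)) * x t / (z t * r t) with hwdef
  have hr : ∀ s ∈ Ioo s₀ S, 0 < r s := fun s hs => by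
    have := hxpos s hs
    exact sqrt_pos.2 (by positivity)
  set q : ℝ → ℝ := fun s => (x s * cos (ψ s) + z s * sin (ψ s)) / r s with hqdef
  have hq : ∀ s ∈ Ioo s₀ S, q s ^ 2 ≤ 1 := fun s hs => by
    have hN : 0 ≤ x s ^ 2 + z s ^ 2 := by positivity
    simp only [hqdef, div_pow]
    rw [div_le_one (pow_pos (hr s hs) 2), hrdef, sq_sqrt hN]
    nlinarith [sq_nonneg (z s * cos (ψ s) - x s * sin (ψ s)), sin_sq_add_cos_sq (ψ s)]
  have hw' : ∀ s ∈ Ioo s₀ S,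
      HasDerivAt w ((1 - (α + 2) * w s * q s + w s ^ 2) / r s) s := fun s hs =>
    hasDerivAt_riccati (hxpos s hs) (hz s hs) (hx' s hs) (hz' s hs) (hψ' s hs)
  have hr' : ∀ s ∈ Ioo s₀ S, HasDerivAt r (q s) s := fun s hs => by
    have h0 := hxpos s hs
    refine (((hx' s hs).fun_pow 2).fun_add ((hz' s hs).fun_pow 2)).sqrt
      (by positivity) |>.congr_deriv ?_
    simp only [hqdef, hrdef]
    field_simp
    norm_num
    ring
  have hG : ∀ s ∈ Ioo s₀ S, HasDerivAt (fun t => arctan (w t) + c * log (r t))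
      (1 / (1 + w s ^ 2) * ((1 - (α + 2) * w s * q s + w s ^ 2) / r s) + c * (q s / r s)) s :=
    fun s hs => (hw' s hs).arctan.fun_add (((hr' s hs).log (hr s hs).ne').const_mul c)
  have hmono : MonotoneOn (fun t => arctan (w t) + c * log (r t)) (Ioo s₀ S) := by
    refine monotoneOn_of_deriv_nonneg (convex_Ioo s₀ S)
      (fun s hs => (hG s hs).continuousAt.continuousWithinAt)
      (fun s hs => (hG s (interior_subset hs)).differentiableAt.differentiableWithinAt) ?_
    intro s hs
    replace hs := interior_subset hs
    rw [(hG s hs).deriv]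
    have hrs := hr s hs
    obtain ⟨hq₁, hq₂⟩ := abs_le.1 (abs_le_one_iff_mul_self_le_one.2
      (by simpa [sq] using hq s hs) : |q s| ≤ 1)
    have key : c * (1 + w s ^ 2) ≤ 1 - (α + 2) * w s * q s + w s ^ 2 := by
      have h1 : |(α + 2) / 2| ≤ 1 - c := abs_le.2 ⟨by linarith, by linarith⟩
      have h2 : |2 * w s * q s| ≤ 1 + w s ^ 2 :=
        abs_le.2 ⟨by nlinarith [sq_nonneg (w s + q s), hq s hs],
          by nlinarith [sq_nonneg (w s - q s), hq s hs]⟩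
      have h3 := mul_le_mul h1 h2 (abs_nonneg _) ((abs_nonneg _).trans h1)
      rw [← abs_mul] at h3
      linarith [le_abs_self ((α + 2) / 2 * (2 * w s * q s))]
    have hpos : 0 < 1 + w s ^ 2 := by positivity
    have : 1 / (1 + w s ^ 2) * ((1 - (α + 2) * w s * q s + w s ^ 2) / r s) + c * (q s / r s) =
        ((1 - (α + 2) * w s * q s + w s ^ 2) / (1 + w s ^ 2) + c * q s) / r s := by
      field_simp
    rw [this]
    have h4 := (le_div_iff₀ hpos).2 key
    exact div_nonneg (by nlinarith) hrs.le
  have hIoo : ∀ᶠ s in nhdsWithin S (Iio S), s ∈ Ioo s₀ S := Ioo_mem_nhdsLT hs₀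
  have hr0 : Tendsto r (nhdsWithin S (Iio S)) (nhdsWithin 0 (Ioi 0)) := by
    refine tendsto_nhdsWithin_iff.2 ⟨?_, hIoo.mono hr⟩
    simpa using ((hxlim.pow 2).add (hzlim.pow 2)).sqrt
  have hlog : Tendsto (fun s => c * log (r s)) (nhdsWithin S (Iio S)) atBot :=
    (tendsto_log_nhdsGT_zero.comp hr0).const_mul_atBot hc
  set m := (s₀ + S) / 2
  have hm : m ∈ Ioo s₀ S := ⟨by simp only [m]; linarith, by simp only [m]; linarith⟩
  obtain ⟨s, hs, hlt⟩ := ((eventually_mem_set.2 (Ioo_mem_nhdsLT hm.2)).and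
    (hlog.eventually_lt_atBot (arctan (w m) + c * log (r m) - π / 2))).exists
  have h := hmono hm ⟨hm.1.trans hs.1, hs.2⟩ hs.1.le
  simp only at h
  linarith [arctan_lt_pi_div_two (w s)]

/-- If `z` and `sin ψ` vanish simultaneously, then the curve is the `x`-axis up to that
parameter. -/
lemma eq_zero_of_tangent {α a b : ℝ} {x z ψ : ℝ → ℝ} (hab : a ≤ b)
    (hxpos : ∀ s ∈ Icc a b, 0 < x s)
    (hx' : ∀ s ∈ Icc a b, HasDerivAt x (cos (ψ s)) s)
    (hz' : ∀ s ∈ Icc a b, HasDerivAt z (sin (ψ s)) s)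
    (hψ' : ∀ s ∈ Icc a b, HasDerivAt ψ
      (α * (z s * cos (ψ s) - x s * sin (ψ s)) / (x s ^ 2 + z s ^ 2) - sin (ψ s) / x s) s)
    (hzb : z b = 0) (hψb : sin (ψ b) = 0) : z a = 0 := by
  have hxc : ContinuousOn x (Icc a b) := fun s hs => (hx' s hs).continuousAt.continuousWithinAt
  have hzc : ContinuousOn z (Icc a b) := fun s hs => (hz' s hs).continuousAt.continuousWithinAt
  have hψc : ContinuousOn ψ (Icc a b) := fun s hs => (hψ' s hs).continuousAt.continuousWithinAt
  have hN : ∀ s ∈ Icc a b, x s ^ 2 + z s ^ 2 ≠ 0 := fun s hs => by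
    have := hxpos s hs
    positivity
  set P : ℝ → ℝ := fun s => 2 + 2 * α * cos (ψ s) ^ 2 / (x s ^ 2 + z s ^ 2) with hP
  set Q : ℝ → ℝ := fun s =>
    -(2 * α * x s * cos (ψ s) / (x s ^ 2 + z s ^ 2)) - 2 * cos (ψ s) / x s with hQ
  have hPc : ContinuousOn P (Icc a b) := by
    refine continuousOn_const.add (ContinuousOn.div ?_ ?_ hN) <;> fun_prop
  have hQc : ContinuousOn Q (Icc a b) := by
    refine (ContinuousOn.div ?_ ?_ hN).neg.sub (ContinuousOn.div ?_ hxc fun s hs =>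
      (hxpos s hs).ne') <;> fun_prop
  obtain ⟨C, hC⟩ := isCompact_Icc.exists_bound_of_continuousOn hPc
  obtain ⟨D, hD⟩ := isCompact_Icc.exists_bound_of_continuousOn hQc
  have hE : z a ^ 2 + sin (ψ a) ^ 2 = 0 := by
    refine eq_zero_left_of_neg_mul_le_deriv (E := fun s => z s ^ 2 + sin (ψ s) ^ 2)
      (E' := fun s => P s * (z s * sin (ψ s)) + Q s * sin (ψ s) ^ 2) (K := C + D) hab
      (fun s hs => ?_) (fun s hs => ?_) (by positivity) (by simp [hzb, hψb])
    · refine (((hz' s hs).fun_pow 2).fun_add ((hψ' s hs).sin.fun_pow 2)).congr_deriv ?_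
      simp only [hP, hQ]
      have := hN s hs
      have := (hxpos s hs).ne'
      field_simp
      norm_num
      ring
    · obtain ⟨hC₁, hC₂⟩ := abs_le.1 (hC s hs)
      obtain ⟨hD₁, hD₂⟩ := abs_le.1 (hD s hs)
      nlinarith [mul_nonneg (sub_nonneg.2 hC₂) (sq_nonneg (z s - sin (ψ s))),
        mul_nonneg (neg_le_iff_add_nonneg.1 hC₁) (sq_nonneg (z s + sin (ψ s))),
        mul_nonneg (neg_le_iff_add_nonneg.1 hD₁) (sq_nonneg (sin (ψ s))),
        mul_nonneg ((norm_nonneg _).trans (hC s hs)) (sq_nonneg (z s)),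
        mul_nonneg ((norm_nonneg _).trans (hC s hs)) (sq_nonneg (sin (ψ s))),
        mul_nonneg ((norm_nonneg _).trans (hD s hs)) (sq_nonneg (z s)),
        mul_nonneg (sub_nonneg.2 hC₂) (sq_nonneg (z s + sin (ψ s))),
        mul_nonneg (neg_le_iff_add_nonneg.1 hC₁) (sq_nonneg (z s - sin (ψ s)))]
  nlinarith [sq_nonneg (z a), sq_nonneg (sin (ψ a))]

/-- Thm. 5.3, case `−4 < α < −2`: if the solution of the rotational
system (eq2) with initial conditions `x(0) = 0`, `z(0) = 1`, `ψ(0) = 0` reaches the origin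
as `s → S⁻`, then the generating curve crosses the `x`-axis infinitely many times near the
origin, and in particular it has points in both open half-planes `z > 0` and `z < 0`. -/
theorem case_alpha_between_minus_four_minus_two (α : ℝ) (hα₁ : -4 < α) (hα₂ : α < -2)
    (S : ℝ) (hS : 0 < S)
    (x z ψ : ℝ → ℝ)
    (hxc : ContinuousOn x (Ico 0 S)) (hzc : ContinuousOn z (Ico 0 S))
    (hψc : ContinuousOn ψ (Ico 0 S))
    (hx0 : x 0 = 0) (hz0 : z 0 = 1) (hψ0 : ψ 0 = 0)
    (hxpos : ∀ s ∈ Ioo 0 S, 0 < x s)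
    (hx' : ∀ s ∈ Ioo 0 S, HasDerivAt x (cos (ψ s)) s)
    (hz' : ∀ s ∈ Ioo 0 S, HasDerivAt z (sin (ψ s)) s)
    (hψ' : ∀ s ∈ Ioo 0 S, HasDerivAt ψ
      (α * (z s * cos (ψ s) - x s * sin (ψ s)) / (x s ^ 2 + z s ^ 2) - sin (ψ s) / x s) s)
    (hxlim : Tendsto x (nhdsWithin S (Iio S)) (nhds 0))
    (hzlim : Tendsto z (nhdsWithin S (Iio S)) (nhds 0)) :
    (∀ s₀ ∈ Ioo 0 S, ∃ s ∈ Ioo s₀ S, z s = 0) ∧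
    (∃ s ∈ Ioo 0 S, 0 < z s) ∧ (∃ s ∈ Ioo 0 S, z s < 0) := by
  have hcross : ∀ s₀ ∈ Ioo 0 S, ∃ s ∈ Ioo s₀ S, z s = 0 := fun s₀ hs₀ => by
    have hmem : ∀ s ∈ Ioo s₀ S, s ∈ Ioo 0 S := fun s hs => ⟨hs₀.1.trans hs.1, hs.2⟩
    exact exists_zero_of_tendsto_origin hα₁ (by linarith) hs₀.2
      (fun s hs => hxpos s (hmem s hs)) (fun s hs => hx' s (hmem s hs))
      (fun s hs => hz' s (hmem s hs)) (fun s hs => hψ' s (hmem s hs)) hxlim hzlim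
  have hpos : ∀ b ∈ Ioo 0 S, ∃ s ∈ Ioo 0 b, 0 < z s := fun b hb => by
    have h0 : Tendsto z (nhdsWithin 0 (Ioo 0 b)) (nhds 1) := hz0 ▸
      (hzc 0 (left_mem_Ico.2 hS)).mono_left
        (nhdsWithin_mono _ fun s hs => ⟨hs.1.le, hs.2.trans hb.2⟩)
    rw [nhdsWithin_Ioo_eq_nhdsGT hb.1] at h0
    exact ((eventually_mem_set.2 (Ioo_mem_nhdsGT hb.1)).and
      (h0.eventually_const_lt one_pos)).exists
  obtain ⟨b, hb, hzb⟩ := hcross (S / 2) ⟨by linarith, by linarith⟩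
  replace hb : b ∈ Ioo 0 S := ⟨by linarith [hb.1], hb.2⟩
  obtain ⟨a, ha, hza⟩ := hpos b hb
  refine ⟨hcross, ⟨a, ⟨ha.1, ha.2.trans hb.2⟩, hza⟩, ?_⟩
  by_contra! hnn
  have hmin : IsLocalMin z b := by
    filter_upwards [Ioo_mem_nhds hb.1 hb.2] with s hs
    exact hzb ▸ hnn s hs
  have hmem : ∀ s ∈ Icc a b, s ∈ Ioo 0 S := fun s hs =>
    ⟨ha.1.trans_le hs.1, hs.2.trans_lt hb.2⟩
  exact hza.ne' (eq_zero_of_tangent ha.2.le (fun s hs => hxpos s (hmem s hs))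
    (fun s hs => hx' s (hmem s hs)) (fun s hs => hz' s (hmem s hs))
    (fun s hs => hψ' s (hmem s hs)) hzb (hmin.hasDerivAt_eq_zero (hz' b hb)))
end

section
/- Let α < −4 and S > 0. Let x, z, ψ : [0, S) → ℝ be continuous on [0, S), differentiable on (0, S), with x(0) = 0, z(0) = 1, ψ(0) = 0, x(s) > 0 for all s ∈ (0, S), and satisfying the system (eq2) on (0, S). Then for every s ∈ (0, S): z(s) > 0, −π < ψ(s) < 0, and sin ψ(s) < 0; in particular z'(s) = sin ψ(s) < 0, so z is strictly decreasing, the generating curve stays in the half-plane z > 0 and is a graph over the z-axis. -/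
open Real Set

theorem exists_lt_of_hasDerivAt_neg {f : ℝ → ℝ} {a c d : ℝ} (hac : a < c) (hd : d < 0)
    (hf : HasDerivAt f d c) : ∃ s ∈ Ioo a c, f c < f s := by
  have h1 := hasDerivAt_iff_tendsto_slope.1 hf
  have h2 : ∀ᶠ s in nhdsWithin c (Iio c), slope f c s < 0 :=
    (h1.mono_left (nhdsWithin_mono c fun s hs => ne_of_lt hs)).eventually_lt_const hd
  obtain ⟨s, hs, hs'⟩ := (h2.and (Ioo_mem_nhdsLT hac)).exists
  refine ⟨s, hs', ?_⟩
  rw [slope_def_field, div_neg_iff] at hs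
  rcases hs with h | h <;> linarith [hs'.2, h.1, h.2]

theorem exists_lt_of_hasDerivAt_pos {f : ℝ → ℝ} {a c d : ℝ} (hac : a < c) (hd : 0 < d)
    (hf : HasDerivAt f d c) : ∃ s ∈ Ioo a c, f s < f c := by
  obtain ⟨s, hs, h⟩ := exists_lt_of_hasDerivAt_neg hac (neg_lt_zero.2 hd) hf.fun_neg
  exact ⟨s, hs, neg_lt_neg_iff.1 h⟩

theorem neg_of_hasDerivAt_neg_of_nonneg {f : ℝ → ℝ} {b : ℝ} (hb : 0 < b)
    (hc : ContinuousOn f (Icc 0 b)) (h0 : f 0 ≤ 0)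
    (hd : ∀ s ∈ Ioc 0 b, 0 ≤ f s → ∃ d < 0, HasDerivAt f d s) : f b < 0 := by
  by_contra! hfb
  obtain ⟨c, hc1, hmax⟩ := isCompact_Icc.exists_isMaxOn ⟨b, right_mem_Icc.2 hb.le⟩ hc
  have key : ∃ c ∈ Ioc 0 b, 0 ≤ f c ∧ ∀ s ∈ Icc 0 b, f s ≤ f c := by
    have hbc := hmax (right_mem_Icc.2 hb.le)
    simp only [mem_ofPred_eq] at hbc
    rcases hc1.1.eq_or_lt with h | h
    · subst h
      exact ⟨b, ⟨hb, le_rfl⟩, hfb, fun s hs => (hmax hs).trans (h0.trans hfb)⟩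
    · exact ⟨c, ⟨h, hc1.2⟩, hfb.trans hbc, fun s hs => hmax hs⟩
  obtain ⟨c, hcI, hc0, hcm⟩ := key
  obtain ⟨d, hd0, hder⟩ := hd c hcI hc0
  obtain ⟨s, hs, hlt⟩ := exists_lt_of_hasDerivAt_neg hcI.1 hd0 hder
  exact absurd (hcm s ⟨hs.1.le, hs.2.le.trans hcI.2⟩) (not_le.2 hlt)

/-- A Grönwall-type bound: a positive `q` with `q' ≥ -q / m` cannot reach zero. -/
theorem pos_of_hasDerivAt_ge_neg_div {q q' : ℝ → ℝ} {a b m : ℝ} (hab : a ≤ b)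
    (hq : ∀ s ∈ Icc a b, HasDerivAt q (q' s) s) (hqa : 0 < q a)
    (hle : ∀ s ∈ Ioo a b, -(q s / m) ≤ q' s) : 0 < q b := by
  have hder : ∀ s ∈ Icc a b, HasDerivAt (fun s => q s * exp (s / m))
      (q' s * exp (s / m) + q s * (exp (s / m) * (1 / m))) s := fun s hs =>
    (hq s hs).mul ((hasDerivAt_id s).div_const m).exp
  have hmono : MonotoneOn (fun s => q s * exp (s / m)) (Icc a b) := by
    apply monotoneOn_of_deriv_nonneg (convex_Icc a b)
    · exact fun s hs => (hder s hs).continuousAt.continuousWithinAt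
    · intro s hs
      exact (hder s (interior_subset hs)).differentiableAt.differentiableWithinAt
    · intro s hs
      rw [(hder s (interior_subset hs)).deriv]
      rw [interior_Icc] at hs
      have h1 := hle s hs
      have : q' s * exp (s / m) + q s * (exp (s / m) * (1 / m))
          = (q' s + q s / m) * exp (s / m) := by ring
      rw [this]
      exact mul_nonneg (by linarith) (exp_pos _).le
  have h := hmono (left_mem_Icc.2 hab) (right_mem_Icc.2 hab) hab
  have h2 : 0 < q a * exp (a / m) := mul_pos hqa (exp_pos _)
  exact pos_of_mul_pos_left (h2.trans_le h) (exp_pos _).le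

/-- Thm. 5.3, case `α < −4`: for a solution of the rotational system (eq2)
with initial conditions `x(0) = 0`, `z(0) = 1`, `ψ(0) = 0`, one has `z > 0`,
`−π < ψ < 0` and `sin ψ < 0` on `(0, S)`; in particular `z' = sin ψ < 0`, so `z` is
strictly decreasing and the generating curve stays in the half-plane `z > 0` and is a
graph over the `z`-axis. -/
theorem case_alpha_less_minus_four (α : ℝ) (hα : α < -4) (S : ℝ) (hS : 0 < S)
    (x z ψ : ℝ → ℝ)
    (hxc : ContinuousOn x (Ico 0 S)) (hzc : ContinuousOn z (Ico 0 S))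
    (hψc : ContinuousOn ψ (Ico 0 S))
    (hx0 : x 0 = 0) (hz0 : z 0 = 1) (hψ0 : ψ 0 = 0)
    (hxpos : ∀ s ∈ Ioo 0 S, 0 < x s)
    (hx' : ∀ s ∈ Ioo 0 S, HasDerivAt x (cos (ψ s)) s)
    (hz' : ∀ s ∈ Ioo 0 S, HasDerivAt z (sin (ψ s)) s)
    (hψ' : ∀ s ∈ Ioo 0 S, HasDerivAt ψ
      (α * (z s * cos (ψ s) - x s * sin (ψ s)) / (x s ^ 2 + z s ^ 2) - sin (ψ s) / x s) s) :
    (∀ s ∈ Ioo 0 S, 0 < z s ∧ (-π < ψ s ∧ ψ s < 0) ∧ sin (ψ s) < 0) ∧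
    StrictAntiOn z (Ico 0 S) := by
  set A : ℝ → ℝ := fun s => z s * cos (ψ s) - x s * sin (ψ s) with hA
  set C : ℝ → ℝ := fun s => z s * sin (ψ s / 2) + x s * cos (ψ s / 2) with hC
  set D : ℝ → ℝ := fun s => z s * cos (ψ s / 2) - x s * sin (ψ s / 2) with hD
  have hAc : ContinuousOn A (Ico 0 S) := by fun_prop
  have hCc : ContinuousOn C (Ico 0 S) := by fun_prop
  have hDc : ContinuousOn D (Ico 0 S) := by fun_prop
  have hsin : ∀ s, sin (ψ s) = 2 * sin (ψ s / 2) * cos (ψ s / 2) := fun s => by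
    rw [← sin_two_mul]; ring_nf
  have hcos : ∀ s, cos (ψ s) = 2 * cos (ψ s / 2) ^ 2 - 1 := fun s => by
    rw [← cos_two_mul]; ring_nf
  have hr : ∀ s ∈ Ioo 0 S, 0 < x s ^ 2 + z s ^ 2 := fun s hs => by
    have := hxpos s hs; positivity
  set ψ' : ℝ → ℝ := fun s => α * (z s * cos (ψ s) - x s * sin (ψ s)) / (x s ^ 2 + z s ^ 2)
    - sin (ψ s) / x s with hψ'def
  have hA' : ∀ s ∈ Ioo 0 S, HasDerivAt A
      (-ψ' s * (x s * cos (ψ s) + z s * sin (ψ s))) s := fun s hs => by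
    refine (((hz' s hs).mul (hψ' s hs).cos).sub ((hx' s hs).mul (hψ' s hs).sin)).congr_deriv ?_
    simp only [hψ'def]
    ring
  have hC' : ∀ s ∈ Ioo 0 S, HasDerivAt C (cos (ψ s / 2) + D s / 2 * ψ' s) s := fun s hs => by
    have hp := (hψ' s hs).div_const 2
    refine (((hz' s hs).mul hp.sin).add ((hx' s hs).mul hp.cos)).congr_deriv ?_
    simp only [hψ'def, hD]
    have h1 : cos (ψ s / 2) = sin (ψ s) * sin (ψ s / 2) + cos (ψ s) * cos (ψ s / 2) := by
      rw [hsin, hcos]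
      linear_combination (-2 * cos (ψ s / 2)) * sin_sq_add_cos_sq (ψ s / 2)
    linear_combination -h1
  have hxCD : ∀ s, C s * cos (ψ s / 2) - D s * sin (ψ s / 2) = x s := fun s => by
    simp only [hC, hD]
    linear_combination x s * sin_sq_add_cos_sq (ψ s / 2)
  have hneg : ∀ s ∈ Ioo 0 S, 0 ≤ C s → 0 < cos (ψ s / 2) →
      4 * cos (ψ s / 2) + α * D s * A s / (x s ^ 2 + z s ^ 2) < 0 →
      cos (ψ s / 2) + D s / 2 * ψ' s < 0 := by
    intro s hs hCs hcs hF
    have hx := hxpos s hs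
    have h1 : -(D s * (sin (ψ s) / x s)) ≤ 2 * cos (ψ s / 2) := by
      rw [← mul_div_assoc, ← neg_div, div_le_iff₀ hx, hsin]
      have h2 := hxCD s
      have h3 : 0 ≤ C s * cos (ψ s / 2) * cos (ψ s / 2) := by positivity
      nlinarith
    have h4 : D s / 2 * ψ' s = (α * D s * A s / (x s ^ 2 + z s ^ 2)
        - D s * (sin (ψ s) / x s)) / 2 := by
      simp only [hψ'def, hA]; ring
    rw [h4]; linarith
  let P : ℝ → Prop := fun s => 0 < z s ∧ 0 < A s ∧ C s < 0 ∧ -π < ψ s ∧ ψ s < 0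
  have h0 : (0 : ℝ) ∈ Ico 0 S := ⟨le_rfl, hS⟩
  have hstart : ∃ ε, 0 < ε ∧ ε ≤ S ∧ ∀ s ∈ Ioo 0 ε, P s := by
    have hF : ContinuousWithinAt
        (fun s => 4 * cos (ψ s / 2) + α * D s * A s / (x s ^ 2 + z s ^ 2)) (Ico 0 S) 0 := by
      have e1 := hψc 0 h0
      have e2 := hDc 0 h0
      have e3 := hAc 0 h0
      have e4 := hxc 0 h0
      have e5 := hzc 0 h0
      exact ((continuous_cos.continuousAt.comp_continuousWithinAt (e1.div_const 2)).const_mul 4).add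
        (((e2.const_mul α).mul e3).div ((e4.pow 2).add (e5.pow 2)) (by simp [hx0, hz0]))
    have f1 := hF.eventually_lt_const (u := 0) (by simp [hx0, hz0, hψ0, hA, hD]; linarith)
    have f2 := (hzc 0 h0).eventually_const_lt (u := 0) (by simp [hz0])
    have f3 := (hAc 0 h0).eventually_const_lt (u := 0) (by simp [hx0, hz0, hψ0, hA])
    have f4 := (hψc 0 h0).eventually_const_lt (u := -π) (by simp [hψ0, pi_pos])
    have f5 := (hψc 0 h0).eventually_lt_const (u := π) (by simp [hψ0, pi_pos])
    obtain ⟨ε, hε, hb⟩ := Metric.mem_nhdsWithin_iff.1 (f1.and (f2.and (f3.and (f4.and f5))))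
    refine ⟨min ε S, lt_min hε hS, min_le_right _ _, ?_⟩
    have hb' : ∀ s ∈ Ico 0 (min ε S), s ∈ Ico 0 S ∧
        4 * cos (ψ s / 2) + α * D s * A s / (x s ^ 2 + z s ^ 2) < 0 ∧ 0 < z s ∧ 0 < A s ∧
        -π < ψ s ∧ ψ s < π := by
      intro s hs
      have hsS : s ∈ Ico 0 S := ⟨hs.1, hs.2.trans_le (min_le_right _ _)⟩
      refine ⟨hsS, hb ⟨?_, hsS⟩⟩
      rw [Metric.mem_ball, Real.dist_eq, sub_zero, abs_of_nonneg hs.1]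
      exact hs.2.trans_le (min_le_left _ _)
    intro s hs
    obtain ⟨hsS, -, hz, hAs, hψ1, hψ2⟩ := hb' s ⟨hs.1.le, hs.2⟩
    have hCs : C s < 0 := by
      apply neg_of_hasDerivAt_neg_of_nonneg hs.1
      · exact hCc.mono fun t ht => ⟨ht.1, ht.2.trans_lt hsS.2⟩
      · simp [hC, hx0, hψ0]
      · intro t ht hCt
        obtain ⟨htS, hFt, -, -, h1, h2⟩ := hb' t ⟨ht.1.le, ht.2.trans_lt hs.2⟩
        have htI : t ∈ Ioo 0 S := ⟨ht.1, htS.2⟩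
        exact ⟨_, hneg t htI hCt (cos_pos_of_mem_Ioo ⟨by linarith, by linarith⟩) hFt, hC' t htI⟩
    refine ⟨hz, hAs, hCs, hψ1, ?_⟩
    by_contra! hψs
    have h1 : 0 ≤ sin (ψ s / 2) := sin_nonneg_of_nonneg_of_le_pi (by linarith) (by linarith)
    have h2 : 0 < cos (ψ s / 2) := cos_pos_of_mem_Ioo ⟨by linarith, by linarith⟩
    have h3 := hxpos s ⟨hs.1, hsS.2⟩
    have : 0 ≤ C s := by simp only [hC]; positivity
    linarith
  have hclosed : ∀ T ∈ Ioo 0 S, (∀ s ∈ Ioo 0 T, P s) → P T := by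
    intro T hT hP
    have hmem : T ∈ closure (Ioo 0 T) := by
      rw [closure_Ioo hT.1.ne]; exact right_mem_Icc.2 hT.1.le
    have hsub : Ioo 0 T ⊆ Ico 0 S := fun s hs => ⟨hs.1.le, hs.2.trans hT.2⟩
    have hTS : T ∈ Ico 0 S := ⟨hT.1.le, hT.2⟩
    have hAT : 0 ≤ A T := ContinuousWithinAt.closure_le hmem continuousWithinAt_const ((hAc T hTS).mono hsub)
      fun s hs => (hP s hs).2.1.le
    have hCT : C T ≤ 0 := ContinuousWithinAt.closure_le hmem ((hCc T hTS).mono hsub) continuousWithinAt_const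
      fun s hs => (hP s hs).2.2.1.le
    have hψ1 : -π ≤ ψ T := ContinuousWithinAt.closure_le hmem continuousWithinAt_const ((hψc T hTS).mono hsub)
      fun s hs => (hP s hs).2.2.2.1.le
    have hψ2 : ψ T ≤ 0 := ContinuousWithinAt.closure_le hmem ((hψc T hTS).mono hsub) continuousWithinAt_const
      fun s hs => (hP s hs).2.2.2.2.le
    have hxT := hxpos T hT
    have hzT : 0 < z T := by
      have hI : Icc (T / 2) T ⊆ Ioo 0 S := fun s hs =>
        ⟨by linarith [hs.1, hT.1], hs.2.trans_lt hT.2⟩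
      obtain ⟨c, hc, hmin⟩ := isCompact_Icc.exists_isMinOn
        (⟨T, ⟨by linarith [hT.1], le_rfl⟩⟩ : (Icc (T / 2) T).Nonempty)
        (hxc.mono (hI.trans Ioo_subset_Ico_self))
      have hm := hxpos c (hI hc)
      have hq := pos_of_hasDerivAt_ge_neg_div (q := fun s => z s / x s)
        (q' := fun s => (sin (ψ s) * x s - z s * cos (ψ s)) / x s ^ 2) (m := x c)
        (a := T / 2) (b := T) (by linarith [hT.1])
        (fun s hs => (hz' s (hI hs)).div (hx' s (hI hs)) (hxpos s (hI hs)).ne')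
        (div_pos (hP _ ⟨by linarith [hT.1], by linarith [hT.1]⟩).1
          (hxpos _ (hI ⟨le_rfl, by linarith [hT.1]⟩)))
        (fun s hs => by
          have hsI := Ioo_subset_Icc_self hs
          have hxs := hxpos s (hI hsI)
          have hxc : x c ≤ x s := hmin hsI
          obtain ⟨hz, -, hCs, h1, h2⟩ := hP s ⟨(hI hsI).1, hs.2⟩
          have hsp : sin (ψ s / 2) < 0 :=
            sin_neg_of_neg_of_neg_pi_lt (by linarith) (by linarith)
          have hAz : A s < z s := by
            have : z s - A s = 2 * sin (ψ s / 2) * C s := by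
              simp only [hA, hC]
              rw [hsin, hcos]
              linear_combination (-2 * z s) * sin_sq_add_cos_sq (ψ s / 2)
            nlinarith [mul_pos_of_neg_of_neg hsp hCs]
          have e1 : (sin (ψ s) * x s - z s * cos (ψ s)) / x s ^ 2 = -(A s / x s ^ 2) := by
            simp only [hA]; ring
          rw [e1, neg_le_neg_iff]
          calc A s / x s ^ 2 ≤ z s / x s ^ 2 := by gcongr
            _ = z s / x s / x s := by rw [div_div, sq]
            _ ≤ z s / x s / x c := by gcongr)
      exact (div_pos_iff_of_pos_right hxT).1 hq
    have hψ1' : -π < ψ T := by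
      refine lt_of_le_of_ne hψ1 fun h => ?_
      have : A T = -z T := by simp [hA, ← h]
      linarith
    have hψ2' : ψ T < 0 := by
      refine lt_of_le_of_ne hψ2 fun h => ?_
      have : C T = x T := by simp [hC, h]
      linarith
    have hsT : sin (ψ T) < 0 := sin_neg_of_neg_of_neg_pi_lt hψ2' hψ1'
    have hspT : sin (ψ T / 2) < 0 := sin_neg_of_neg_of_neg_pi_lt (by linarith) (by linarith)
    have hcpT : 0 < cos (ψ T / 2) := cos_pos_of_mem_Ioo ⟨by linarith, by linarith⟩
    refine ⟨hzT, lt_of_le_of_ne hAT fun h => ?_, lt_of_le_of_ne hCT fun h => ?_, hψ1', hψ2'⟩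
    · have h1 : z T * cos (ψ T) - x T * sin (ψ T) = 0 := h.symm
      have h2 : cos (ψ T) < 0 := by
        by_contra! h3
        nlinarith [mul_nonneg hzT.le h3, mul_neg_of_pos_of_neg hxT hsT]
      have h4 : 0 < ψ' T := by
        simp only [hψ'def, h1, mul_zero, zero_div, zero_sub, ← neg_div]
        exact div_pos (neg_pos.2 hsT) hxT
      have h5 : x T * cos (ψ T) + z T * sin (ψ T) < 0 :=
        add_neg (mul_neg_of_pos_of_neg hxT h2) (mul_neg_of_pos_of_neg hzT hsT)
      obtain ⟨s, hs, hlt⟩ := exists_lt_of_hasDerivAt_pos hT.1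
        (mul_pos_of_neg_of_neg (neg_lt_zero.2 h4) h5) (hA' T hT)
      linarith [(hP s hs).2.1]
    · have hDx : -(D T * sin (ψ T / 2)) = x T := by
        have := hxCD T; rw [h] at this; linarith
      have hDA : D T * A T = (x T ^ 2 + z T ^ 2) * cos (ψ T / 2) := by
        have h1 : z T * sin (ψ T / 2) + x T * cos (ψ T / 2) = 0 := h
        have hA2 : A T = D T * cos (ψ T / 2) - C T * sin (ψ T / 2) := by
          simp only [hA, hC, hD]
          rw [hsin, hcos]
          linear_combination z T * sin_sq_add_cos_sq (ψ T / 2)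
        have hr2 : x T ^ 2 + z T ^ 2 = D T ^ 2 + C T ^ 2 := by
          simp only [hC, hD]
          linear_combination (-(x T ^ 2 + z T ^ 2)) * sin_sq_add_cos_sq (ψ T / 2)
        rw [hr2, hA2, h]; ring
      have hF : 4 * cos (ψ T / 2) + α * D T * A T / (x T ^ 2 + z T ^ 2) < 0 := by
        rw [mul_assoc, hDA, mul_div_assoc, mul_div_cancel_left₀ _ (hr T hT).ne']
        nlinarith
      obtain ⟨s, hs, hlt⟩ := exists_lt_of_hasDerivAt_neg hT.1
        (hneg T hT h.ge hcpT hF) (hC' T hT)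
      linarith [(hP s hs).2.2.1]
  have hmain : ∀ s ∈ Ioo 0 S, P s := by
    by_contra! hbad
    obtain ⟨ε, hε, hεS, hPε⟩ := hstart
    obtain ⟨b, hb, hPb⟩ := hbad
    let B : Set ℝ := {s | s ∈ Ioo 0 S ∧ ¬ P s}
    have hBne : B.Nonempty := ⟨b, hb, hPb⟩
    have hBbd : BddBelow B := ⟨0, fun s hs => hs.1.1.le⟩
    have hεT : ε ≤ sInf B := le_csInf hBne fun s hs => by
      by_contra! hlt
      exact hs.2 (hPε s ⟨hs.1.1, hlt⟩)
    have hT : sInf B ∈ Ioo 0 S := ⟨hε.trans_le hεT, (csInf_le hBbd ⟨hb, hPb⟩).trans_lt hb.2⟩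
    have hPT := hclosed _ hT fun s hs => by
      by_contra hPs
      exact absurd (csInf_le hBbd ⟨⟨hs.1, hs.2.trans hT.2⟩, hPs⟩) (not_le.2 hs.2)
    have hnear : ∀ᶠ s in nhds (sInf B), P s := by
      have hN := Ico_mem_nhds hT.1 hT.2
      have c1 := (hzc.continuousAt hN).eventually_const_lt hPT.1
      have c2 := (hAc.continuousAt hN).eventually_const_lt hPT.2.1
      have c3 := (hCc.continuousAt hN).eventually_lt_const hPT.2.2.1
      have c4 := (hψc.continuousAt hN).eventually_const_lt hPT.2.2.2.1
      have c5 := (hψc.continuousAt hN).eventually_lt_const hPT.2.2.2.2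
      exact c1.and (c2.and (c3.and (c4.and c5)))
    obtain ⟨s, hs1, hs2⟩ := mem_closure_iff_nhds.1 (csInf_mem_closure hBne hBbd) _ hnear
    exact hs2.2 hs1
  have hfin : ∀ s ∈ Ioo 0 S, sin (ψ s) < 0 := fun s hs =>
    sin_neg_of_neg_of_neg_pi_lt (hmain s hs).2.2.2.2 (hmain s hs).2.2.2.1
  refine ⟨fun s hs => ⟨(hmain s hs).1, (hmain s hs).2.2.2, hfin s hs⟩, ?_⟩
  apply strictAntiOn_of_deriv_neg (convex_Ico 0 S) hzc
  intro s hs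
  rw [interior_Ico] at hs
  rw [(hz' s hs).deriv]
  exact hfin s hs
end

section
/- Let α ≠ 0 and S > 0, and let x, z, ψ : (−S, S) → ℝ be differentiable functions with x(s) > 0 on (−S, S), satisfying the system (eq2) on (−S, S) and the initial conditions (ini2): x(0) = 1, z(0) = 0, ψ(0) = π/2. Then the solution is symmetric about the x-axis: for all s ∈ (−S, S), x(−s) = x(s), z(−s) = −z(s) and ψ(−s) = π − ψ(s). -/
open Real Set

/-- Two integral curves of an autonomous vector field that is `C¹` along both of them coincide on
an open interval as soon as they meet there. -/
theorem eqOn_Ioo_of_hasDerivAt_of_contDiffAt {E : Type*} [NormedAddCommGroup E] [NormedSpace ℝ E]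
    {v : E → E} {f g : ℝ → E} {a b t₀ : ℝ} (ht₀ : t₀ ∈ Ioo a b)
    (hf : ∀ t ∈ Ioo a b, HasDerivAt f (v (f t)) t) (hg : ∀ t ∈ Ioo a b, HasDerivAt g (v (g t)) t)
    (hvf : ∀ t ∈ Ioo a b, ContDiffAt ℝ 1 v (f t)) (hvg : ∀ t ∈ Ioo a b, ContDiffAt ℝ 1 v (g t))
    (heq : f t₀ = g t₀) : EqOn f g (Ioo a b) := by
  intro t ht
  obtain ⟨c, hac, hc⟩ := exists_between (lt_min ht₀.1 ht.1)
  obtain ⟨d, hd, hdb⟩ := exists_between (max_lt ht₀.2 ht.2)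
  rw [lt_min_iff] at hc
  rw [max_lt_iff] at hd
  have hsub : Icc c d ⊆ Ioo a b := Icc_subset_Ioo hac hdb
  have hK : IsCompact (f '' Icc c d ∪ g '' Icc c d) :=
    (isCompact_Icc.image_of_continuousOn (HasDerivAt.continuousOn fun s hs ↦ hf s (hsub hs))).union
      (isCompact_Icc.image_of_continuousOn (HasDerivAt.continuousOn fun s hs ↦ hg s (hsub hs)))
  have hloc : LocallyLipschitzOn (f '' Icc c d ∪ g '' Icc c d) v := by
    intro y hy
    have hvy : ContDiffAt ℝ 1 v y := by
      rcases hy with ⟨s, hs, rfl⟩ | ⟨s, hs, rfl⟩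
      exacts [hvf s (hsub hs), hvg s (hsub hs)]
    obtain ⟨L, U, hU, hL⟩ := hvy.exists_lipschitzOnWith
    exact ⟨L, U, mem_nhdsWithin_of_mem_nhds hU, hL⟩
  obtain ⟨L, hL⟩ := hloc.exists_lipschitzOnWith_of_compact hK
  have hsub' : Ioo c d ⊆ Icc c d := Ioo_subset_Icc_self
  exact ODE_solution_unique_of_mem_Ioo (v := fun _ ↦ v) (fun _ _ ↦ hL) ⟨hc.1, hd.1⟩
    (fun s hs ↦ ⟨hf s (hsub (hsub' hs)), .inl (mem_image_of_mem f (hsub' hs))⟩)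
    (fun s hs ↦ ⟨hg s (hsub (hsub' hs)), .inr (mem_image_of_mem g (hsub' hs))⟩)
    heq ⟨hc.2, hd.2⟩

/-- The right-hand side of the system satisfied by the generating curve `(x, z, ψ)` of a rotational
`α`-stationary surface. -/
noncomputable def stationaryField (α : ℝ) (p : ℝ × ℝ × ℝ) : ℝ × ℝ × ℝ :=
  (cos p.2.2, sin p.2.2,
    α * (p.2.1 * cos p.2.2 - p.1 * sin p.2.2) / (p.1 ^ 2 + p.2.1 ^ 2) - sin p.2.2 / p.1)

theorem contDiffAt_stationaryField (α : ℝ) {p : ℝ × ℝ × ℝ} (hp : 0 < p.1) :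
    ContDiffAt ℝ 1 (stationaryField α) p := by
  have hx : ContDiffAt ℝ 1 (fun q : ℝ × ℝ × ℝ ↦ q.1) p := contDiffAt_fst
  have hz : ContDiffAt ℝ 1 (fun q : ℝ × ℝ × ℝ ↦ q.2.1) p := contDiffAt_fst.comp p contDiffAt_snd
  have hψ : ContDiffAt ℝ 1 (fun q : ℝ × ℝ × ℝ ↦ q.2.2) p := contDiffAt_snd.comp p contDiffAt_snd
  have hd : p.1 ^ 2 + p.2.1 ^ 2 ≠ 0 := by positivity
  exact hψ.cos.prodMk <| hψ.sin.prodMk <|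
    ((contDiffAt_const.mul ((hz.mul hψ.cos).sub (hx.mul hψ.sin))).div
      ((hx.pow 2).add (hz.pow 2)) hd).sub (hψ.sin.div hx hp.ne')

/-- the solution of the rotational system (eq2) with initial conditions
(ini2) `x(0) = 1`, `z(0) = 0`, `ψ(0) = π/2` is symmetric about the `x`-axis:
`x(−s) = x(s)`, `z(−s) = −z(s)`, `ψ(−s) = π − ψ(s)`. -/
theorem symmetry_about_x_axis (α : ℝ) (hα : α ≠ 0) (S : ℝ) (hS : 0 < S)
    (x z ψ : ℝ → ℝ)
    (hxpos : ∀ s ∈ Ioo (-S) S, 0 < x s)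
    (hx0 : x 0 = 1) (hz0 : z 0 = 0) (hψ0 : ψ 0 = π / 2)
    (hx' : ∀ s ∈ Ioo (-S) S, HasDerivAt x (cos (ψ s)) s)
    (hz' : ∀ s ∈ Ioo (-S) S, HasDerivAt z (sin (ψ s)) s)
    (hψ' : ∀ s ∈ Ioo (-S) S, HasDerivAt ψ
      (α * (z s * cos (ψ s) - x s * sin (ψ s)) / (x s ^ 2 + z s ^ 2) - sin (ψ s) / x s) s) :
    ∀ s ∈ Ioo (-S) S, x (-s) = x s ∧ z (-s) = -z s ∧ ψ (-s) = π - ψ s := by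
  have hneg : ∀ s ∈ Ioo (-S) S, -s ∈ Ioo (-S) S := fun s hs ↦ ⟨neg_lt_neg hs.2, neg_lt.1 hs.1⟩
  have key : EqOn (fun s ↦ (x (-s), -z (-s), π - ψ (-s))) (fun s ↦ (x s, z s, ψ s))
      (Ioo (-S) S) := by
    refine eqOn_Ioo_of_hasDerivAt_of_contDiffAt (v := stationaryField α) (t₀ := 0)
      ⟨neg_lt_zero.2 hS, hS⟩ (fun s hs ↦ ?_)
      (fun s hs ↦ (hx' s hs).prodMk ((hz' s hs).prodMk (hψ' s hs)))
      (fun s hs ↦ contDiffAt_stationaryField α (hxpos _ (hneg s hs)))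
      (fun s hs ↦ contDiffAt_stationaryField α (hxpos s hs)) ?_
    · have h1 := (hx' _ (hneg s hs)).scomp s (hasDerivAt_neg s)
      have h2 := ((hz' _ (hneg s hs)).scomp s (hasDerivAt_neg s)).neg
      have h3 := ((hψ' _ (hneg s hs)).scomp s (hasDerivAt_neg s)).const_sub π
      refine (h1.prodMk (h2.prodMk h3)).congr_deriv ?_
      simp only [stationaryField, cos_pi_sub, sin_pi_sub, smul_eq_mul, Prod.mk.injEq]
      refine ⟨by ring, by ring, by ring⟩
    · simp only [neg_zero, hx0, hz0, hψ0, Prod.mk.injEq, true_and]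
      ring
  intro s hs
  have h := key hs
  simp only [Prod.mk.injEq] at h
  exact ⟨h.1, by linarith [h.2.1], by linarith [h.2.2]⟩
end
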